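/- Let O be an orbifold on ℂP¹ and let U and V be rational maps of degree at least two. If U ∈ E(O) and V ∈ E(O), then U ∘ V ∈ E(O). Conversely, if U ∘ V ∈ E(O), then the pullback orbifold U*O has the same signature as O, and V : O → U*O and U : U*O → O are minimal holomorphic maps between orbifolds; in particular, whenever the signature of O is not {2,2,2,2}, there exists a Möbius transformation μ such that U ∘ μ ∈ E(O) and μ⁻¹ ∘ V ∈ E(O). -/

import Mathlib

open Polynomial OnePoint
open scoped Classical

noncomputable section

namespace GenLattes

/-- Composition of rational functions: `rcomp f g = f ∘ g`. -/
def rcomp (f g : RatFunc ℂ) : RatFunc ℂ :=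
  Polynomial.aeval g f.num / Polynomial.aeval g f.denom

/-- The degree of a rational function: the maximum of the degrees of its numerator and
denominator in lowest terms. -/
def rdeg (f : RatFunc ℂ) : ℕ := max f.num.natDegree f.denom.natDegree

/-- Evaluation of a rational function at a finite point, with value in the Riemann
sphere `ℂP¹ = OnePoint ℂ`. -/
def evalF (f : RatFunc ℂ) (z : ℂ) : OnePoint ℂ :=
  if f.denom.eval z = 0 then ∞ else ((f.num.eval z / f.denom.eval z : ℂ) : OnePoint ℂ)

/-- The local degree (local multiplicity) of a rational function at a finite point. -/
def locDegF (f : RatFunc ℂ) (z : ℂ) : ℕ :=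
  if f.denom.eval z = 0 then rootMultiplicity z f.denom
  else rootMultiplicity z (f.num - Polynomial.C (f.num.eval z / f.denom.eval z) * f.denom)

/-- The rational function `f(1/X)`. -/
def flip (f : RatFunc ℂ) : RatFunc ℂ := rcomp f (RatFunc.X)⁻¹

/-- The self-map of the Riemann sphere `ℂP¹ = OnePoint ℂ` induced by a rational function. -/
def evalOP (f : RatFunc ℂ) (x : OnePoint ℂ) : OnePoint ℂ :=
  OnePoint.rec (evalF (flip f) 0) (fun z => evalF f z) x

/-- The local degree `deg_x f` of a rational function at a point of the Riemann sphere. -/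
def locDeg (f : RatFunc ℂ) (x : OnePoint ℂ) : ℕ :=
  OnePoint.rec (locDegF (flip f) 0) (fun z => locDegF f z) x

/-- The iterate `f^{∘l}` of a rational function (with `riter f 0 = X = id`). -/
def riter (f : RatFunc ℂ) : ℕ → RatFunc ℂ
  | 0 => RatFunc.X
  | l + 1 => rcomp f (riter f l)

/-- An orbifold on the Riemann sphere: a ramification function `ν : ℂP¹ → ℕ` with
`ν(z) ≥ 1` everywhere and `ν(z) = 1` outside a finite set. -/
structure Orbifold where
  nu : OnePoint ℂ → ℕ
  one_le : ∀ z, 1 ≤ nu z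
  finite : {z : OnePoint ℂ | nu z ≠ 1}.Finite

/-- A good orbifold: it is forbidden to have exactly one point with `ν > 1`, or exactly
two such points with different values of `ν`. -/
def Orbifold.Good (O : Orbifold) : Prop :=
  (¬ ∃ z, {w : OnePoint ℂ | O.nu w ≠ 1} = {z}) ∧
  (¬ ∃ z₁ z₂, z₁ ≠ z₂ ∧ {w : OnePoint ℂ | O.nu w ≠ 1} = {z₁, z₂} ∧ O.nu z₁ ≠ O.nu z₂)

/-- A nontrivial orbifold (distinct from the non-ramified sphere). -/
def Orbifold.IsNontrivial (O : Orbifold) : Prop := ∃ z, 1 < O.nu z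

/-- The relation `O₁ ⪯ O₂`: pointwise divisibility of ramification functions. -/
def Orbifold.Prec (O₁ O₂ : Orbifold) : Prop := ∀ z, O₁.nu z ∣ O₂.nu z

/-- The signature of an orbifold: the multiset of values of `ν` on `c(O) = {ν > 1}`. -/
def Orbifold.signature (O : Orbifold) : Multiset ℕ := O.finite.toFinset.val.map O.nu

/-- The Euler characteristic `χ(O) = 2 + Σ (1/ν(z) - 1)`. -/
def Orbifold.eulerChar (O : Orbifold) : ℚ :=
  2 + ∑ z ∈ O.finite.toFinset, ((O.nu z : ℚ)⁻¹ - 1)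

/-- `A : O₁ → O₂` is a holomorphic map between orbifolds:
`ν₂(A(z)) ∣ ν₁(z)·deg_z A` for all `z`. -/
def IsHolo (A : RatFunc ℂ) (O₁ O₂ : Orbifold) : Prop :=
  ∀ z, O₂.nu (evalOP A z) ∣ O₁.nu z * locDeg A z

/-- `A : O₁ → O₂` is a minimal holomorphic map between orbifolds:
`ν₂(A(z)) = ν₁(z)·gcd(deg_z A, ν₂(A(z)))` for all `z`. -/
def IsMinHolo (A : RatFunc ℂ) (O₁ O₂ : Orbifold) : Prop :=
  ∀ z, O₂.nu (evalOP A z) = O₁.nu z * Nat.gcd (locDeg A z) (O₂.nu (evalOP A z))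

/-- `A : O₁ → O₂` is a covering map between orbifolds:
`ν₂(A(z)) = ν₁(z)·deg_z A` for all `z`. -/
def IsCovering (A : RatFunc ℂ) (O₁ O₂ : Orbifold) : Prop :=
  ∀ z, O₂.nu (evalOP A z) = O₁.nu z * locDeg A z

/-- `A` and `B` are conjugate by a Möbius transformation: `A = μ ∘ B ∘ μ⁻¹`. -/
def Conjugate (A B : RatFunc ℂ) : Prop :=
  ∃ μ ν : RatFunc ℂ, rcomp μ ν = RatFunc.X ∧ rcomp ν μ = RatFunc.X ∧
    A = rcomp (rcomp μ B) ν

/-- The Chebyshev polynomial `T_d` viewed as a rational function. -/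
def chebyRF (d : ℕ) : RatFunc ℂ :=
  algebraMap (Polynomial ℂ) (RatFunc ℂ) (Polynomial.Chebyshev.T ℂ d)

end GenLattes

namespace GenLattes

/-- The order of vanishing of a rational function at a point of the Riemann sphere. -/
def rord (x : OnePoint ℂ) (f : RatFunc ℂ) : ℤ :=
  OnePoint.rec (-f.intDegree)
    (fun z => (rootMultiplicity z f.num : ℤ) - rootMultiplicity z f.denom) x

/-- The rational function vanishing to order `deg_z f` at `z` when `f z = x`. -/
def coord (x : OnePoint ℂ) (f : RatFunc ℂ) : RatFunc ℂ :=
  OnePoint.rec f⁻¹ (fun c => f - RatFunc.C c) x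

@[simp] lemma rord_infty (f : RatFunc ℂ) : rord ∞ f = -f.intDegree := rfl

lemma rord_coe (z : ℂ) (f : RatFunc ℂ) :
    rord z f = (rootMultiplicity z f.num : ℤ) - rootMultiplicity z f.denom := rfl

@[simp] lemma coord_infty (f : RatFunc ℂ) : coord ∞ f = f⁻¹ := rfl

@[simp] lemma coord_coe (c : ℂ) (f : RatFunc ℂ) : coord c f = f - RatFunc.C c := rfl

lemma rord_coe_div (z : ℂ) {p q : ℂ[X]} (hp : p ≠ 0) (hq : q ≠ 0) :
    rord z (algebraMap _ (RatFunc ℂ) p / algebraMap _ (RatFunc ℂ) q) =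
      (rootMultiplicity z p : ℤ) - rootMultiplicity z q := by
  set f : RatFunc ℂ := algebraMap _ (RatFunc ℂ) p / algebraMap _ (RatFunc ℂ) q with hf
  have hq' := RatFunc.algebraMap_ne_zero (K := ℂ) hq
  have hp' := RatFunc.algebraMap_ne_zero (K := ℂ) hp
  have hf0 : f ≠ 0 := div_ne_zero hp' hq'
  have h : f.num * q = p * f.denom := by
    rw [RatFunc.num_mul_eq_mul_denom_iff hq]
  have hn := RatFunc.num_ne_zero hf0
  have h2 := congrArg (rootMultiplicity z) h
  rw [rootMultiplicity_mul (mul_ne_zero hn hq),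
    rootMultiplicity_mul (mul_ne_zero hp f.denom_ne_zero)] at h2
  rw [rord_coe]
  omega

lemma rord_infty_div {p q : ℂ[X]} (hp : p ≠ 0) (hq : q ≠ 0) :
    rord ∞ (algebraMap _ (RatFunc ℂ) p / algebraMap _ (RatFunc ℂ) q) =
      (q.natDegree : ℤ) - p.natDegree := by
  rw [rord_infty, RatFunc.intDegree_div (RatFunc.algebraMap_ne_zero hp)
    (RatFunc.algebraMap_ne_zero hq)]
  simp

lemma rord_mul (x : OnePoint ℂ) {f g : RatFunc ℂ} (hf : f ≠ 0) (hg : g ≠ 0) :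
    rord x (f * g) = rord x f + rord x g := by
  induction x using OnePoint.rec with
  | infty => simp [RatFunc.intDegree_mul hf hg]; ring
  | coe z =>
    have hnf := RatFunc.num_ne_zero hf
    have hng := RatFunc.num_ne_zero hg
    conv_lhs => rw [← f.num_div_denom, ← g.num_div_denom, div_mul_div_comm, ← map_mul, ← map_mul]
    rw [rord_coe_div z (mul_ne_zero hnf hng) (mul_ne_zero f.denom_ne_zero g.denom_ne_zero),
      rootMultiplicity_mul (mul_ne_zero hnf hng),
      rootMultiplicity_mul (mul_ne_zero f.denom_ne_zero g.denom_ne_zero), rord_coe, rord_coe]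
    push_cast; ring

@[simp] lemma rord_C (x : OnePoint ℂ) (c : ℂ) : rord x (RatFunc.C c) = 0 := by
  induction x using OnePoint.rec with
  | infty => simp
  | coe z => simp [rord_coe, ← Polynomial.C_1, -map_one]

@[simp] lemma rord_one (x : OnePoint ℂ) : rord x 1 = 0 := by
  simpa using rord_C x 1

@[simp] lemma rord_zero (x : OnePoint ℂ) : rord x 0 = 0 := by
  simpa using rord_C x 0

lemma rord_inv (x : OnePoint ℂ) (f : RatFunc ℂ) : rord x f⁻¹ = -rord x f := by
  by_cases hf : f = 0
  · simp [hf]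
  · have := rord_mul x hf (inv_ne_zero hf)
    rw [mul_inv_cancel₀ hf, rord_one] at this
    omega

lemma rord_div (x : OnePoint ℂ) {f g : RatFunc ℂ} (hf : f ≠ 0) (hg : g ≠ 0) :
    rord x (f / g) = rord x f - rord x g := by
  rw [div_eq_mul_inv, rord_mul x hf (inv_ne_zero hg), rord_inv]; ring

lemma add_C_eq (f : RatFunc ℂ) (c : ℂ) :
    f + RatFunc.C c = algebraMap _ (RatFunc ℂ) (f.num + Polynomial.C c * f.denom) /
      algebraMap _ (RatFunc ℂ) f.denom := by
  have hd := RatFunc.algebraMap_ne_zero (K := ℂ) f.denom_ne_zero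
  rw [map_add, map_mul, RatFunc.algebraMap_C, add_div, RatFunc.num_div_denom,
    mul_div_cancel_right₀ _ hd]

lemma not_root_both (f : RatFunc ℂ) (z : ℂ) : ¬ (f.num.eval z = 0 ∧ f.denom.eval z = 0) := by
  rintro ⟨h1, h2⟩
  obtain ⟨a, b, h⟩ := f.isCoprime_num_denom
  have := congrArg (Polynomial.eval z) h
  simp [h1, h2] at this

lemma rord_add_C (x : OnePoint ℂ) {f : RatFunc ℂ} (hf : 0 < rord x f) {c : ℂ} (hc : c ≠ 0) :
    rord x (f + RatFunc.C c) = 0 := by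
  have hd := f.denom_ne_zero
  rw [add_C_eq]
  induction x using OnePoint.rec with
  | infty =>
    rw [rord_infty, RatFunc.intDegree] at hf
    have hlt : f.num.natDegree < (Polynomial.C c * f.denom).natDegree := by
      rw [natDegree_C_mul hc]; omega
    have h0 := natDegree_add_eq_right_of_natDegree_lt hlt
    have hne : f.num + Polynomial.C c * f.denom ≠ 0 := by
      intro h; rw [h, natDegree_zero] at h0; omega
    rw [rord_infty_div hne hd, h0, natDegree_C_mul hc]; simp
  | coe z =>
    rw [rord_coe] at hf
    have hz : f.num.eval z = 0 := by
      by_contra h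
      have := rootMultiplicity_eq_zero (p := f.num) (x := z) h
      omega
    have hz' : f.denom.eval z ≠ 0 := fun h => not_root_both f z ⟨hz, h⟩
    have hn : (f.num + Polynomial.C c * f.denom).eval z ≠ 0 := by simp [hz, hc, hz']
    have hne : f.num + Polynomial.C c * f.denom ≠ 0 := by
      intro h; simp [h] at hn
    rw [rord_coe_div z hne hd, rootMultiplicity_eq_zero hn, rootMultiplicity_eq_zero hz']; simp

/-- A rational function is nonconstant. -/
def Nonconst (f : RatFunc ℂ) : Prop := ¬ ∃ c, f = RatFunc.C c

lemma nonconst_of_rdeg {f : RatFunc ℂ} (h : 1 ≤ rdeg f) : Nonconst f := by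
  rw [Nonconst, RatFunc.eq_C_iff]
  rintro ⟨h1, h2⟩
  simp [rdeg, h1, h2] at h

lemma Nonconst.ne_zero {f : RatFunc ℂ} (h : Nonconst f) : f ≠ 0 := by
  rintro rfl; exact h ⟨0, by simp⟩

lemma Nonconst.sub_C_ne_zero {f : RatFunc ℂ} (h : Nonconst f) (c : ℂ) : f - RatFunc.C c ≠ 0 :=
  fun h' => h ⟨c, sub_eq_zero.mp h'⟩

lemma Nonconst.coord_ne_zero {f : RatFunc ℂ} (h : Nonconst f) (x : OnePoint ℂ) :
    coord x f ≠ 0 := by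
  induction x using OnePoint.rec with
  | infty => simpa using h.ne_zero
  | coe c => simpa using h.sub_C_ne_zero c

lemma nonconst_of_rord {x z : OnePoint ℂ} {f : RatFunc ℂ} (h : 0 < rord z (coord x f)) :
    Nonconst f := by
  rintro ⟨c, rfl⟩
  induction x using OnePoint.rec with
  | infty => rw [coord_infty, ← map_inv₀, rord_C] at h; omega
  | coe w => rw [coord_coe, ← map_sub, rord_C] at h; omega

/-- Precomposition with a nonconstant rational function, as an algebra homomorphism. -/
def compHom (g : RatFunc ℂ) (hg : Nonconst g) : RatFunc ℂ →ₐ[ℂ] RatFunc ℂ :=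
  RatFunc.liftAlgHom (Polynomial.aeval g)
    (nonZeroDivisors_le_comap_nonZeroDivisors_of_injective _
      (transcendental_iff_injective.mp (RatFunc.transcendental_of_ne_C g hg)))

lemma compHom_apply (g : RatFunc ℂ) (hg : Nonconst g) (f : RatFunc ℂ) :
    compHom g hg f = rcomp f g := by
  conv_lhs => rw [← f.num_div_denom]
  exact RatFunc.liftAlgHom_apply_div _ _ _ _

@[simp] lemma compHom_C (g : RatFunc ℂ) (hg : Nonconst g) (c : ℂ) :
    compHom g hg (RatFunc.C c) = RatFunc.C c := by
  rw [← RatFunc.algebraMap_eq_C]; exact AlgHom.commutes _ _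

@[simp] lemma compHom_X (g : RatFunc ℂ) (hg : Nonconst g) : compHom g hg RatFunc.X = g := by
  rw [compHom_apply]; simp [rcomp]

lemma coord_rcomp (x : OnePoint ℂ) (f : RatFunc ℂ) {g : RatFunc ℂ} (hg : Nonconst g) :
    coord x (rcomp f g) = rcomp (coord x f) g := by
  rw [← compHom_apply g hg, ← compHom_apply g hg]
  induction x using OnePoint.rec with
  | infty => simp
  | coe c => simp

lemma nonconst_rcomp {f g : RatFunc ℂ} (hf : Nonconst f) (hg : Nonconst g) :
    Nonconst (rcomp f g) := by
  rintro ⟨c, hc⟩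
  rw [← compHom_apply g hg, ← compHom_C g hg] at hc
  exact hf ⟨c, (compHom g hg).injective hc⟩

lemma rcomp_assoc (f g : RatFunc ℂ) {h : RatFunc ℂ} (hh : Nonconst h) :
    rcomp (rcomp f g) h = rcomp f (rcomp g h) := by
  rw [← compHom_apply h hh, rcomp, map_div₀, ← Polynomial.aeval_algHom_apply,
    ← Polynomial.aeval_algHom_apply, compHom_apply]
  rfl

lemma rord_X_sub_C (x : OnePoint ℂ) (w : ℂ) :
    rord x (RatFunc.X - RatFunc.C w) = if x = ∞ then -1 else if x = w then 1 else 0 := by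
  have h : (RatFunc.X - RatFunc.C w : RatFunc ℂ) = algebraMap ℂ[X] _ (X - Polynomial.C w) := by
    simp [RatFunc.algebraMap_X, RatFunc.algebraMap_C]
  induction x using OnePoint.rec with
  | infty => rw [h, rord_infty, RatFunc.intDegree_polynomial]; simp
  | coe z =>
    rw [h, rord_coe, RatFunc.num_algebraMap, RatFunc.denom_algebraMap, rootMultiplicity_X_sub_C]
    rw [← Polynomial.C_1, rootMultiplicity_C]
    by_cases h : z = w <;> simp [h]

lemma rord_sub_C {x z : OnePoint ℂ} {g : RatFunc ℂ} (h : 0 < rord z (coord x g)) (w : ℂ) :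
    rord z (g - RatFunc.C w) = rord z (coord x g) * rord x (RatFunc.X - RatFunc.C w) := by
  have hg := nonconst_of_rord h
  rw [rord_X_sub_C]
  induction x using OnePoint.rec with
  | infty =>
    simp only [coord_infty, if_true] at h ⊢
    rw [rord_inv] at h ⊢
    by_cases hw : w = 0
    · simp [hw]
    · have hCw : RatFunc.C (-w) ≠ 0 := by simpa using hw
      have e : g - RatFunc.C w = g * (g⁻¹ * RatFunc.C (-w) + RatFunc.C 1) := by
        have := hg.ne_zero
        field_simp
        rw [map_neg, map_one]; ring
      have h1 : rord z (g⁻¹ * RatFunc.C (-w) + RatFunc.C 1) = 0 := by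
        apply rord_add_C _ _ one_ne_zero
        rw [rord_mul z (inv_ne_zero hg.ne_zero) hCw, rord_inv, rord_C]; omega
      have h2 : g⁻¹ * RatFunc.C (-w) + RatFunc.C 1 ≠ 0 := by
        intro h0; rw [h0, mul_zero] at e; exact hg.sub_C_ne_zero w e
      rw [e, rord_mul z hg.ne_zero h2, h1]; ring
  | coe c =>
    simp only [coord_coe, OnePoint.coe_ne_infty, if_false, OnePoint.coe_eq_coe] at h ⊢
    by_cases hcw : c = w
    · simp [hcw]
    · have e : g - RatFunc.C w = (g - RatFunc.C c) + RatFunc.C (c - w) := by simp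
      rw [e, rord_add_C z h (sub_ne_zero.mpr hcw)]; simp [hcw]

lemma rord_compHom {x z : OnePoint ℂ} {g : RatFunc ℂ} (h : 0 < rord z (coord x g))
    (f : RatFunc ℂ) :
    rord z (rcomp f g) = rord z (coord x g) * rord x f := by
  have hg := nonconst_of_rord h
  by_cases hf : f = 0
  · rw [← compHom_apply g hg]; simp [hf]
  have hs : ∀ s : Multiset ℂ, (s.map fun w => g - RatFunc.C w).prod ≠ 0 ∧
      (s.map fun w => (RatFunc.X - RatFunc.C w : RatFunc ℂ)).prod ≠ 0 ∧
      rord z (s.map fun w => g - RatFunc.C w).prod = rord z (coord x g) *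
        rord x (s.map fun w => (RatFunc.X - RatFunc.C w : RatFunc ℂ)).prod := by
    intro s
    induction s using Multiset.induction with
    | empty => simp
    | cons w s ih =>
      obtain ⟨h1, h2, h3⟩ := ih
      have hX : (RatFunc.X - RatFunc.C w : RatFunc ℂ) ≠ 0 := by
        intro h0
        have := rord_X_sub_C ∞ w
        rw [h0] at this; simp at this
      simp only [Multiset.map_cons, Multiset.prod_cons]
      refine ⟨mul_ne_zero (hg.sub_C_ne_zero w) h1, mul_ne_zero hX h2, ?_⟩
      rw [rord_mul z (hg.sub_C_ne_zero w) h1, rord_mul x hX h2, h3, rord_sub_C h]; ring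
  have hp : ∀ p : ℂ[X], p ≠ 0 → rord z (compHom g hg (algebraMap _ (RatFunc ℂ) p)) =
      rord z (coord x g) * rord x (algebraMap _ (RatFunc ℂ) p) := by
    intro p hp
    obtain ⟨h1, h2, h3⟩ := hs p.roots
    have hl : RatFunc.C p.leadingCoeff ≠ 0 := by simpa using hp
    have e : algebraMap _ (RatFunc ℂ) p = RatFunc.C p.leadingCoeff *
        (p.roots.map fun w => (RatFunc.X - RatFunc.C w : RatFunc ℂ)).prod := by
      conv_lhs => rw [(IsAlgClosed.splits p).eq_prod_roots]
      rw [map_mul, map_multiset_prod, Multiset.map_map, RatFunc.algebraMap_C]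
      simp [Function.comp_def, RatFunc.algebraMap_X, RatFunc.algebraMap_C]
    have e' : compHom g hg (algebraMap _ (RatFunc ℂ) p) = RatFunc.C p.leadingCoeff *
        (p.roots.map fun w => g - RatFunc.C w).prod := by
      rw [e, map_mul, map_multiset_prod, Multiset.map_map, compHom_C]
      simp
    rw [e', e, rord_mul z hl h1, rord_mul x hl h2, h3]; simp
  have hn := RatFunc.num_ne_zero hf
  have hd := f.denom_ne_zero
  have inj : ∀ {a : RatFunc ℂ}, a ≠ 0 → compHom g hg a ≠ 0 := fun ha =>
    (map_ne_zero_iff _ (compHom g hg).injective).mpr ha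
  have hn' := RatFunc.algebraMap_ne_zero (K := ℂ) hn
  have hd' := RatFunc.algebraMap_ne_zero (K := ℂ) hd
  rw [← compHom_apply g hg]
  conv_lhs => rw [← f.num_div_denom]
  conv_rhs => rw [← f.num_div_denom]
  rw [map_div₀, rord_div z (inj hn') (inj hd'), rord_div x hn' hd', hp _ hn, hp _ hd]; ring

lemma evalOP_infty (f : RatFunc ℂ) : evalOP f ∞ = evalF (flip f) 0 := rfl
lemma locDeg_infty (f : RatFunc ℂ) : locDeg f ∞ = locDegF (flip f) 0 := rfl

lemma sub_C_eq (f : RatFunc ℂ) (c : ℂ) :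
    f - RatFunc.C c = algebraMap _ (RatFunc ℂ) (f.num - Polynomial.C c * f.denom) /
      algebraMap _ (RatFunc ℂ) f.denom := by
  have := add_C_eq f (-c)
  rw [map_neg, map_neg] at this
  rw [sub_eq_add_neg, this]; congr 2; ring

lemma Nonconst.num_sub_ne_zero {f : RatFunc ℂ} (hf : Nonconst f) (c : ℂ) :
    f.num - Polynomial.C c * f.denom ≠ 0 := by
  intro h
  have := sub_C_eq f c
  rw [h] at this
  exact hf.sub_C_ne_zero c (by simpa using this)

lemma rord_coord_evalF {f : RatFunc ℂ} (hf : Nonconst f) (z : ℂ) :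
    0 < rord z (coord (evalF f z) f) ∧ (locDegF f z : ℤ) = rord z (coord (evalF f z) f) := by
  by_cases h : f.denom.eval z = 0
  · have hn : f.num.eval z ≠ 0 := fun h' => not_root_both f z ⟨h', h⟩
    have := (rootMultiplicity_pos f.denom_ne_zero).mpr (h : f.denom.IsRoot z)
    simp only [evalF, locDegF, h, if_true, coord_infty, rord_inv]
    rw [rord_coe, rootMultiplicity_eq_zero hn]
    omega
  · simp only [evalF, locDegF, h, if_false, coord_coe]
    have hne := hf.num_sub_ne_zero (f.num.eval z / f.denom.eval z)
    rw [sub_C_eq, rord_coe_div z hne f.denom_ne_zero, rootMultiplicity_eq_zero (p := f.denom) h]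
    have := (rootMultiplicity_pos hne (x := z)).mpr (by
      simp only [IsRoot, eval_sub, eval_mul, eval_C]; field_simp; ring)
    simp only [Nat.cast_zero, sub_zero, and_true]
    exact_mod_cast this

lemma nonconst_X_inv : Nonconst (RatFunc.X⁻¹ : RatFunc ℂ) := by
  rintro ⟨c, hc⟩
  have := congrArg (rord ∞) hc
  rw [rord_inv, rord_C, rord_infty, RatFunc.intDegree_X] at this
  omega

lemma rord_flip (f : RatFunc ℂ) : rord (0 : ℂ) (flip f) = rord ∞ f := by
  have h : rord (0 : ℂ) (coord ∞ (RatFunc.X⁻¹ : RatFunc ℂ)) = 1 := by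
    have := rord_X_sub_C ((0 : ℂ) : OnePoint ℂ) 0
    simpa using this
  rw [flip, rord_compHom (by omega : 0 < rord (0 : ℂ) (coord ∞ (RatFunc.X⁻¹ : RatFunc ℂ))), h]
  ring

lemma rord_coord_evalOP {f : RatFunc ℂ} (hf : Nonconst f) (z : OnePoint ℂ) :
    0 < rord z (coord (evalOP f z) f) ∧ (locDeg f z : ℤ) = rord z (coord (evalOP f z) f) := by
  induction z using OnePoint.rec with
  | infty =>
    have hflip : Nonconst (flip f) := nonconst_rcomp hf nonconst_X_inv
    have := rord_coord_evalF hflip 0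
    rw [evalOP_infty, locDeg_infty, ← rord_flip (coord _ f)]
    have h : ∀ x, coord x (flip f) = flip (coord x f) := fun x => coord_rcomp x f nonconst_X_inv
    rwa [h] at this
  | coe z => exact rord_coord_evalF hf z

lemma rord_coord_unique {f : RatFunc ℂ} {x y z : OnePoint ℂ} (hx : 0 < rord z (coord x f))
    (hy : 0 < rord z (coord y f)) : x = y := by
  have key : ∀ {x : OnePoint ℂ} {w : ℂ}, 0 < rord z (coord x f) → 0 < rord z (coord w f) →
      x = w := by
    intro x w hx hw
    rw [coord_coe, rord_sub_C hx, rord_X_sub_C] at hw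
    by_contra hne
    split_ifs at hw <;> simp at hw
    omega
  induction y using OnePoint.rec with
  | infty =>
    induction x using OnePoint.rec with
    | infty => rfl
    | coe w => exact (key hy hx).symm
  | coe w => exact key hx hy

lemma evalOP_eq_iff {f : RatFunc ℂ} (hf : Nonconst f) {x z : OnePoint ℂ} :
    evalOP f z = x ↔ 0 < rord z (coord x f) := by
  constructor
  · rintro rfl; exact (rord_coord_evalOP hf z).1
  · intro h; exact rord_coord_unique (rord_coord_evalOP hf z).1 h

lemma locDeg_eq {f : RatFunc ℂ} (hf : Nonconst f) {x z : OnePoint ℂ} (h : evalOP f z = x) :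
    (locDeg f z : ℤ) = rord z (coord x f) := by
  subst h; exact (rord_coord_evalOP hf z).2

lemma locDeg_pos {f : RatFunc ℂ} (hf : Nonconst f) (z : OnePoint ℂ) : 0 < locDeg f z := by
  have := rord_coord_evalOP hf z
  omega

lemma rord_coord_rcomp {f g : RatFunc ℂ} (hg : Nonconst g) (x z : OnePoint ℂ) :
    rord z (coord x (rcomp f g)) = locDeg g z * rord (evalOP g z) (coord x f) := by
  rw [coord_rcomp x f hg, rord_compHom (rord_coord_evalOP hg z).1, (rord_coord_evalOP hg z).2]

lemma evalOP_rcomp {f g : RatFunc ℂ} (hf : Nonconst f) (hg : Nonconst g) (z : OnePoint ℂ) :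
    evalOP (rcomp f g) z = evalOP f (evalOP g z) := by
  rw [evalOP_eq_iff (nonconst_rcomp hf hg), rord_coord_rcomp hg]
  exact mul_pos (by exact_mod_cast locDeg_pos hg z) (rord_coord_evalOP hf _).1

lemma locDeg_rcomp {f g : RatFunc ℂ} (hf : Nonconst f) (hg : Nonconst g) (z : OnePoint ℂ) :
    locDeg (rcomp f g) z = locDeg g z * locDeg f (evalOP g z) := by
  have := locDeg_eq (nonconst_rcomp hf hg) (evalOP_rcomp hf hg z)
  rw [rord_coord_rcomp hg, ← (rord_coord_evalOP hf _).2] at this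
  exact_mod_cast this

lemma rdeg_div {p q : ℂ[X]} (h : IsCoprime p q) (hq : q ≠ 0) :
    rdeg (algebraMap _ (RatFunc ℂ) p / algebraMap _ (RatFunc ℂ) q) =
      max p.natDegree q.natDegree := by
  set f : RatFunc ℂ := algebraMap _ (RatFunc ℂ) p / algebraMap _ (RatFunc ℂ) q with hf
  have e : f.num * q = p * f.denom := by
    rw [RatFunc.num_mul_eq_mul_denom_iff hq]
  have c := f.isCoprime_num_denom
  have h1 : Associated f.num p := associated_of_dvd_dvd
    (c.dvd_of_dvd_mul_right (e ▸ dvd_mul_right _ _)) (h.dvd_of_dvd_mul_right (e ▸ dvd_mul_right _ _))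
  have h2 : Associated f.denom q := associated_of_dvd_dvd
    (c.symm.dvd_of_dvd_mul_left (e ▸ dvd_mul_left _ _))
    (h.symm.dvd_of_dvd_mul_left (e ▸ dvd_mul_left _ _))
  rw [rdeg, natDegree_eq_of_degree_eq (degree_eq_degree_of_associated h1),
    natDegree_eq_of_degree_eq (degree_eq_degree_of_associated h2)]

lemma rdeg_coord (x : OnePoint ℂ) {f : RatFunc ℂ} (hf : Nonconst f) :
    rdeg (coord x f) = rdeg f := by
  have hc := f.isCoprime_num_denom
  induction x using OnePoint.rec with
  | infty =>
    rw [coord_infty]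
    conv_lhs => rw [← f.num_div_denom, inv_div]
    rw [rdeg_div hc.symm (RatFunc.num_ne_zero hf.ne_zero), rdeg, max_comm]
  | coe c =>
    have : IsCoprime (f.num - Polynomial.C c * f.denom) f.denom := by
      simpa [sub_eq_add_neg] using hc.add_mul_right_left (-Polynomial.C c)
    rw [coord_coe, sub_C_eq, rdeg_div this f.denom_ne_zero, rdeg]
    have h1 := natDegree_sub_le f.num (Polynomial.C c * f.denom)
    have h2 := natDegree_C_mul_le c f.denom
    have h3 := natDegree_add_le (f.num - Polynomial.C c * f.denom) (Polynomial.C c * f.denom)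
    rw [sub_add_cancel] at h3
    omega

/-- The inclusion of the finite plane into the Riemann sphere. -/
def coeEmb : ℂ ↪ OnePoint ℂ := ⟨fun z => z, OnePoint.coe_injective⟩

@[simp] lemma coeEmb_apply (z : ℂ) : coeEmb z = (z : OnePoint ℂ) := rfl

lemma exists_zeros {h : RatFunc ℂ} (h0 : h ≠ 0) :
    ∃ F : Finset (OnePoint ℂ), (∀ z, z ∈ F ↔ 0 < rord z h) ∧ ∑ z ∈ F, rord z h = rdeg h := by
  have hn := RatFunc.num_ne_zero h0
  let G : Finset (OnePoint ℂ) := h.num.roots.toFinset.map coeEmb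
  let I : Finset (OnePoint ℂ) := if h.num.natDegree < h.denom.natDegree then {∞} else ∅
  have hroot : ∀ z : ℂ, h.num.eval z = 0 → rord z h = rootMultiplicity z h.num := by
    intro z hz
    have : h.denom.eval z ≠ 0 := fun h' => not_root_both h z ⟨hz, h'⟩
    rw [rord_coe, rootMultiplicity_eq_zero this]; simp
  refine ⟨G ∪ I, ?_, ?_⟩
  · intro z
    induction z using OnePoint.rec with
    | infty =>
      simp only [G, I, Finset.mem_union, Finset.mem_map, rord_infty, RatFunc.intDegree]
      split_ifs with hi <;> simp [hi]
    | coe z =>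
      have : (z : OnePoint ℂ) ∉ I := by simp only [I]; split_ifs <;> simp
      simp only [Finset.mem_union, this, or_false, G]
      have : (z : OnePoint ℂ) = coeEmb z := rfl
      rw [this, Finset.mem_map' , Multiset.mem_toFinset, mem_roots hn, ← this]
      constructor
      · intro hz
        rw [hroot z hz]
        exact_mod_cast (rootMultiplicity_pos hn).mpr hz
      · intro hz
        by_contra hr
        rw [rord_coe, rootMultiplicity_eq_zero hr] at hz
        omega
  · have hd : Disjoint G I := by
      rw [Finset.disjoint_left]
      intro z hz hz'
      simp only [G, Finset.mem_map] at hz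
      obtain ⟨w, -, rfl⟩ := hz
      simp only [I] at hz'
      split_ifs at hz' <;> simp at hz'
    rw [Finset.sum_union hd, Finset.sum_map]
    have h1 : ∑ z ∈ h.num.roots.toFinset, rord (coeEmb z) h = h.num.natDegree := by
      rw [(IsAlgClosed.splits h.num).natDegree_eq_card_roots, ← Multiset.toFinset_sum_count_eq]
      push_cast
      apply Finset.sum_congr rfl
      intro z hz
      rw [Multiset.mem_toFinset, mem_roots hn] at hz
      rw [count_roots]
      exact hroot z hz
    rw [h1]
    simp only [I, rdeg]
    split_ifs with hi
    · simp [RatFunc.intDegree]; omega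
    · simp; omega

lemma exists_fibre {f : RatFunc ℂ} (hf : Nonconst f) (x : OnePoint ℂ) :
    ∃ F : Finset (OnePoint ℂ), (∀ z, z ∈ F ↔ evalOP f z = x) ∧ ∑ z ∈ F, locDeg f z = rdeg f := by
  obtain ⟨F, h1, h2⟩ := exists_zeros (hf.coord_ne_zero x)
  refine ⟨F, fun z => by rw [h1, evalOP_eq_iff hf], ?_⟩
  rw [rdeg_coord x hf] at h2
  zify
  rw [← h2]
  exact Finset.sum_congr rfl fun z hz => locDeg_eq hf ((evalOP_eq_iff hf).mpr ((h1 z).mp hz))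

lemma wronskian_sub_C_mul (p q : ℂ[X]) (c : ℂ) :
    wronskian (p - Polynomial.C c * q) q = wronskian p q := by
  simp only [wronskian, derivative_sub, derivative_mul, derivative_C]; ring

lemma wronskian_ne_zero {f : RatFunc ℂ} (hf : Nonconst f) : wronskian f.num f.denom ≠ 0 := by
  rw [Ne, f.isCoprime_num_denom.wronskian_eq_zero_iff]
  rintro ⟨h1, h2⟩
  exact hf (f.eq_C_iff.mpr ⟨derivative_eq_zero.mp h1, derivative_eq_zero.mp h2⟩)

lemma locDegF_sub_one_le {f : RatFunc ℂ} (hf : Nonconst f) (z : ℂ) :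
    locDegF f z - 1 ≤ rootMultiplicity z (wronskian f.num f.denom) := by
  rw [le_rootMultiplicity_iff (wronskian_ne_zero hf)]
  rw [locDegF]
  split_ifs with h
  · have h1 := pow_rootMultiplicity_dvd f.denom z
    exact dvd_sub (((pow_sub_one_dvd_derivative_of_pow_dvd h1)).mul_left _)
      (((pow_dvd_pow _ (Nat.sub_le _ 1)).trans h1).mul_left _)
  · have h1 := pow_rootMultiplicity_dvd
      (f.num - Polynomial.C (f.num.eval z / f.denom.eval z) * f.denom) z
    rw [← wronskian_sub_C_mul f.num f.denom (f.num.eval z / f.denom.eval z)]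
    exact dvd_sub (((pow_dvd_pow _ (Nat.sub_le _ 1)).trans h1).mul_right _)
      (((pow_sub_one_dvd_derivative_of_pow_dvd h1)).mul_right _)

lemma natDegree_wronskian_le {f : RatFunc ℂ} (hf : Nonconst f) :
    (wronskian f.num f.denom).natDegree + locDeg f ∞ + 1 ≤ 2 * rdeg f := by
  have hW := wronskian_ne_zero hf
  have h := locDeg_eq hf (rfl : evalOP f ∞ = _)
  generalize evalOP f ∞ = x at h
  induction x using OnePoint.rec with
  | infty =>
    have := natDegree_wronskian_lt_add hW
    rw [coord_infty, rord_inv, rord_infty, RatFunc.intDegree] at h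
    have := locDeg_pos hf ∞
    rw [rdeg]; omega
  | coe c =>
    rw [← wronskian_sub_C_mul _ _ c] at hW
    have := natDegree_wronskian_lt_add hW
    rw [wronskian_sub_C_mul] at this
    rw [coord_coe, sub_C_eq, rord_infty_div (hf.num_sub_ne_zero c) f.denom_ne_zero] at h
    rw [rdeg]; omega

/-- The Riemann–Hurwitz inequality. -/
lemma sum_locDeg_sub_one_le {f : RatFunc ℂ} (hf : Nonconst f) (F : Finset (OnePoint ℂ)) :
    ∑ z ∈ F, ((locDeg f z : ℤ) - 1) ≤ 2 * rdeg f - 2 := by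
  have hW := wronskian_ne_zero hf
  let G : Finset ℂ := F.preimage (fun z : ℂ => (z : OnePoint ℂ)) OnePoint.coe_injective.injOn
  have hG : ∑ z ∈ G, (locDegF f z - 1) ≤ (wronskian f.num f.denom).natDegree := by
    calc ∑ z ∈ G, (locDegF f z - 1)
        ≤ ∑ z ∈ G, (wronskian f.num f.denom).roots.count z := Finset.sum_le_sum fun z _ => by
          rw [count_roots]; exact locDegF_sub_one_le hf z
      _ ≤ (wronskian f.num f.denom).roots.card := by
          rw [← Multiset.toFinset_sum_count_eq]
          apply Finset.sum_le_sum_of_ne_zero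
          intro z _ hz
          simpa [and_comm] using hz
      _ ≤ _ := card_roots' _
  have hF : F ⊆ insert ∞ (G.map coeEmb) := by
    intro z hz
    induction z using OnePoint.rec with
    | infty => simp
    | coe z =>
      refine Finset.mem_insert_of_mem (Finset.mem_map.mpr ⟨z, ?_, rfl⟩)
      simpa [G] using hz
  have hle : ∑ z ∈ F, (locDeg f z - 1) ≤
      (locDeg f ∞ - 1) + (wronskian f.num f.denom).natDegree := by
    refine (Finset.sum_le_sum_of_subset hF).trans ?_
    rw [Finset.sum_insert (by simp), Finset.sum_map]
    exact Nat.add_le_add_left hG _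
  have e : ∑ z ∈ F, ((locDeg f z : ℤ) - 1) = ((∑ z ∈ F, (locDeg f z - 1) : ℕ) : ℤ) := by
    push_cast
    refine Finset.sum_congr rfl fun z _ => ?_
    have := locDeg_pos hf z
    omega
  have := natDegree_wronskian_le hf
  have := locDeg_pos hf ∞
  rw [e]
  omega

/-- The arithmetic relations between the signatures of `O₁` and `O₂` that are forced by the
existence of a minimal holomorphic map `O₁ → O₂`. -/
structure SigLink (S T : Multiset ℕ) : Prop where
  dvd : ∀ s ∈ S, ∃ t ∈ T, s ∣ t
  countP_le : ∀ p a b : ℕ, p.Prime → a ≠ 0 → b ≠ 0 → (∀ t ∈ T, ¬ p ^ (a + 1) ∣ t) →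
    S.countP (p ^ a ∣ ·) = 1 → T.countP (p ^ b ∣ ·) ≤ S.countP (p ^ b ∣ ·)
  even : ∀ a : ℕ, a ≠ 0 → (∀ t ∈ T, ¬ 2 ^ (a + 1) ∣ t) →
    Even (T.countP (2 ^ a ∣ ·)) → Even (S.countP (2 ^ a ∣ ·))

/-- The Euler characteristic attached to a signature. -/
def sigChi (S : Multiset ℕ) : ℚ := 2 + (S.map fun n : ℕ => (n : ℚ)⁻¹ - 1).sum

lemma sum_le_of_two_le {S : Multiset ℕ} (hS : ∀ n ∈ S, 2 ≤ n) :
    (S.map fun n : ℕ => (n : ℚ)⁻¹ - 1).sum ≤ -(S.card : ℚ) / 2 := by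
  induction S using Multiset.induction with
  | empty => simp
  | cons n S ih =>
    have h2 : (2 : ℚ) ≤ n := by exact_mod_cast hS n (Multiset.mem_cons_self n S)
    have : (n : ℚ)⁻¹ ≤ 2⁻¹ := inv_anti₀ (by norm_num) h2
    have := ih fun m hm => hS m (Multiset.mem_cons_of_mem hm)
    simp only [Multiset.map_cons, Multiset.sum_cons, Multiset.card_cons]
    push_cast
    linarith

lemma classify_triple {a b c : ℕ} (ha : 2 ≤ a) (hab : a ≤ b) (hbc : b ≤ c)
    (h : 1 ≤ (a : ℚ)⁻¹ + (b : ℚ)⁻¹ + (c : ℚ)⁻¹) :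
    (a = 2 ∧ b = 2) ∨ (a = 2 ∧ b = 3 ∧ c ≤ 6) ∨ (a = 2 ∧ b = 4 ∧ c = 4) ∨
      (a = 3 ∧ b = 3 ∧ c = 3) := by
  have hinv : ∀ {k n : ℕ}, 0 < k → k ≤ n → (n : ℚ)⁻¹ ≤ (k : ℚ)⁻¹ := fun hk hkn =>
    inv_anti₀ (by exact_mod_cast hk) (by exact_mod_cast hkn)
  have ha3 : a ≤ 3 := by
    by_contra! h4
    have h1 := hinv (by norm_num) (h4 : 4 ≤ a)
    have h2 := hinv (by norm_num) (h4.trans_le hab : 4 ≤ b)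
    have h3 := hinv (by norm_num) ((h4.trans_le hab).trans_le hbc : 4 ≤ c)
    norm_num at h1 h2 h3
    linarith
  have hcb := hinv (by omega) hbc
  interval_cases a
  · have hb4 : b ≤ 4 := by
      by_contra! h5
      have h2 := hinv (by norm_num) (h5 : 5 ≤ b)
      norm_num at h2 h
      linarith
    interval_cases b
    · simp
    · have : c ≤ 6 := by
        by_contra! h7
        have h3 := hinv (by norm_num) (h7 : 7 ≤ c)
        norm_num at h3 h
        linarith
      simp [this]
    · have : c ≤ 4 := by
        by_contra! h5
        have h3 := hinv (by norm_num) (h5 : 5 ≤ c)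
        norm_num at h3 h
        linarith
      simp; omega
  · have hb : b ≤ 3 := by
      by_contra! h4
      have h2 := hinv (by norm_num) (h4 : 4 ≤ b)
      norm_num at h2 h hcb
      linarith
    have hc : c ≤ 3 := by
      by_contra! h4
      have h3 := hinv (by norm_num) (h4 : 4 ≤ c)
      have h2 := hinv (by norm_num) hab
      norm_num at h3 h2 h
      linarith
    omega

lemma classify {S : Multiset ℕ} (hS : ∀ n ∈ S, 2 ≤ n) (hchi : 0 ≤ sigChi S) :
    (0 < sigChi S ∧ (S = 0 ∨ (∃ n, 2 ≤ n ∧ S = {n}) ∨ (∃ k m, 2 ≤ k ∧ k ≤ m ∧ S = {k, m}) ∨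
      (∃ n, 2 ≤ n ∧ S = {2, 2, n}) ∨ S = {2, 3, 3} ∨ S = {2, 3, 4} ∨ S = {2, 3, 5})) ∨
    (sigChi S = 0 ∧ (S = {3, 3, 3} ∨ S = {2, 4, 4} ∨ S = {2, 3, 6} ∨ S = {2, 2, 2, 2})) := by
  have hcard : S.card ≤ 4 := by
    have := sum_le_of_two_le hS
    rw [sigChi] at hchi
    have : (S.card : ℚ) ≤ 4 := by linarith
    exact_mod_cast this
  have hs := S.sort_eq (· ≤ ·)
  have hp := S.pairwise_sort (· ≤ ·)
  generalize S.sort (· ≤ ·) = l at hs hp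
  subst hs
  rw [Multiset.coe_card] at hcard
  have hpos : ∀ n : ℕ, 0 < n → 0 < (n : ℚ)⁻¹ := fun n hn => by positivity
  have hinv : ∀ {k n : ℕ}, 0 < k → k ≤ n → (n : ℚ)⁻¹ ≤ (k : ℚ)⁻¹ := fun hk hkn =>
    inv_anti₀ (by exact_mod_cast hk) (by exact_mod_cast hkn)
  match l, hcard, hp with
  | [], _, _ => left; simp [sigChi]
  | [n], _, _ =>
    have h2 : 2 ≤ n := hS n (by simp)
    left
    refine ⟨?_, Or.inr (Or.inl ⟨n, h2, rfl⟩)⟩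
    have := hpos n (by omega)
    simp [sigChi]; linarith
  | [k, m], _, hp =>
    have hk : 2 ≤ k := hS k (by simp)
    have hkm : k ≤ m := by simpa using hp
    left
    refine ⟨?_, Or.inr (Or.inr (Or.inl ⟨k, m, hk, hkm, rfl⟩))⟩
    have := hpos k (by omega)
    have := hpos m (by omega)
    simp [sigChi]; linarith
  | [a, b, c], _, hp =>
    have ha : 2 ≤ a := hS a (by simp)
    have hab : a ≤ b ∧ a ≤ c ∧ b ≤ c := by simpa [and_assoc] using hp
    have h : 1 ≤ (a : ℚ)⁻¹ + (b : ℚ)⁻¹ + (c : ℚ)⁻¹ := by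
      simp [sigChi] at hchi; linarith
    rcases classify_triple ha hab.1 hab.2.2 h with ⟨rfl, rfl⟩ | ⟨rfl, rfl, h6⟩ | ⟨rfl, rfl, rfl⟩ |
      ⟨rfl, rfl, rfl⟩
    · left
      refine ⟨?_, Or.inr (Or.inr (Or.inr (Or.inl ⟨c, by omega, rfl⟩)))⟩
      have := hpos c (by omega)
      simp [sigChi]; linarith
    · have h3 : 3 ≤ c := hab.2.2
      interval_cases c
      · left; exact ⟨by norm_num [sigChi], by tauto⟩
      · left; exact ⟨by norm_num [sigChi], by tauto⟩
      · left; exact ⟨by norm_num [sigChi], by tauto⟩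
      · right; exact ⟨by norm_num [sigChi], by tauto⟩
    · right; exact ⟨by norm_num [sigChi], by tauto⟩
    · right; exact ⟨by norm_num [sigChi], by tauto⟩
  | [a, b, c, d], _, hp =>
    have ha : 2 ≤ a := hS a (by simp)
    have h1 : (a ≤ b ∧ a ≤ c ∧ a ≤ d) ∧ (b ≤ c ∧ b ≤ d) ∧ c ≤ d := by simpa using hp
    have hd : d ≤ 2 := by
      by_contra! h3
      have e1 := hinv (by norm_num) (hS a (by simp))
      have e2 := hinv (by norm_num) (hS b (by simp))
      have e3 := hinv (by norm_num) (hS c (by simp))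
      have e4 := hinv (by norm_num) (h3 : 3 ≤ d)
      simp [sigChi] at hchi
      norm_num at e1 e2 e3 e4
      linarith
    obtain rfl : a = 2 := by omega
    obtain rfl : b = 2 := by omega
    obtain rfl : c = 2 := by omega
    obtain rfl : d = 2 := by omega
    right; exact ⟨by norm_num [sigChi], by tauto⟩

lemma exists_top {n p : ℕ} (hn : n ≠ 0) (hp : p.Prime) (h : p ∣ n) :
    ∃ a, a ≠ 0 ∧ p ^ a ∣ n ∧ ¬ p ^ (a + 1) ∣ n := by
  refine ⟨n.factorization p, ?_, Nat.ordProj_dvd n p, Nat.pow_succ_factorization_not_dvd hn hp⟩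
  have := (hp.dvd_iff_one_le_factorization hn).mp h
  omega

lemma exists_top_of_proper {k n : ℕ} (hn : n ≠ 0) (hk : k ∣ n) (hne : k ≠ n) :
    ∃ p a, p.Prime ∧ a ≠ 0 ∧ p ^ a ∣ n ∧ ¬ p ^ (a + 1) ∣ n ∧ ¬ p ^ a ∣ k := by
  by_contra! hcon
  apply hne
  apply Nat.dvd_antisymm hk
  rw [Nat.dvd_iff_prime_pow_dvd_dvd]
  intro p b hp hb
  by_cases hb0 : b = 0
  · simp [hb0]
  obtain ⟨a, ha, h1, h2⟩ := exists_top hn hp ((dvd_pow_self p hb0).trans hb)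
  have : b ≤ a := by
    by_contra! hlt
    exact h2 ((pow_dvd_pow p hlt).trans hb)
  exact (pow_dvd_pow p this).trans (hcon p a hp ha h1 h2)

lemma SigLink.not_dvd {S T : Multiset ℕ} (h : SigLink S T) {q : ℕ} (hT : ∀ t ∈ T, ¬ q ∣ t) :
    ∀ s ∈ S, ¬ q ∣ s := by
  intro s hs hq
  obtain ⟨t, ht, hst⟩ := h.dvd s hs
  exact hT t ht (hq.trans hst)

lemma sig_pair_single {n m : ℕ} (hn : 2 ≤ n) (h : SigLink {n, n} {m}) (h' : SigLink {m} {n, n}) :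
    False := by
  have h1 := h.dvd
  have h2 := h'.dvd
  simp at h1 h2
  obtain rfl := Nat.dvd_antisymm h1 h2
  obtain ⟨a, ha, h3, h4⟩ := exists_top (by omega : n ≠ 0) (Nat.minFac_prime (by omega : n ≠ 1))
    n.minFac_dvd
  have := h'.countP_le n.minFac a a (Nat.minFac_prime (by omega)) ha ha (by simpa using h4)
  simp [← Multiset.cons_zero, h3] at this

lemma sig_pair_pair {n k m : ℕ} (hn : 2 ≤ n) (hkm : k ≤ m) (hk : 2 ≤ k) (h : SigLink {n, n} {k, m})
    (h' : SigLink {k, m} {n, n}) : ({n, n} : Multiset ℕ) = {k, m} := by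
  have h1 := h.dvd
  have h2 := h'.dvd
  simp at h1 h2
  obtain rfl : n = m := by
    refine Nat.dvd_antisymm ?_ h2.2
    rcases h1 with h1 | h1
    · obtain rfl := Nat.dvd_antisymm h1 h2.1
      rw [le_antisymm hkm (Nat.le_of_dvd (by omega) h2.2)]
    · exact h1
  by_cases hne : k = n
  · rw [hne]
  obtain ⟨p, a, hp, ha, h3, h4, h5⟩ := exists_top_of_proper (by omega) h2.1 hne
  have := h'.countP_le _ a a hp ha ha (by simpa using h4)
  simp [← Multiset.cons_zero, h3, h5] at this

lemma sig_pair_dihedral {n m : ℕ} (hn : 2 ≤ n) (hm : 2 ≤ m) (h : SigLink {n, n} {2, 2, m})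
    (h' : SigLink {2, 2, m} {n, n}) : False := by
  have h1 := h.dvd
  have h2 := h'.dvd
  simp at h1 h2
  obtain rfl : n = m := by
    refine Nat.dvd_antisymm ?_ h2.2
    rcases h1 with h1 | h1
    · obtain rfl := Nat.dvd_antisymm h1 h2.1
      exact (by have := Nat.le_of_dvd (by omega) h2.2; rw [show m = 2 by omega])
    · exact h1
  obtain ⟨a, ha, h3, h4⟩ := exists_top (by omega) Nat.prime_two h2.1
  by_cases ha1 : a = 1
  · subst ha1
    have := h'.even 1 one_ne_zero (by simpa using h4)
    simp [← Multiset.cons_zero, h2.1] at this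
    exact absurd this (by decide)
  · have h5 : ¬ 2 ^ a ∣ 2 := fun hd => by
      have := (pow_dvd_pow 2 (by omega : 2 ≤ a)).trans hd
      norm_num at this
    have := h'.countP_le 2 a a Nat.prime_two ha ha (by simpa using h4)
    simp [← Multiset.cons_zero, h3, h5] at this

lemma not_pow_succ_dvd_two {a : ℕ} (ha : a ≠ 0) : ¬ 2 ^ (a + 1) ∣ 2 := fun hd => by
  have := (pow_dvd_pow 2 (by omega : 2 ≤ a + 1)).trans hd
  norm_num at this

lemma sig_dihedral_single {n m : ℕ} (hm : 2 ≤ m) (h : SigLink {2, 2, n} {m})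
    (h' : SigLink {m} {2, 2, n}) : False := by
  have h1 := h.dvd
  simp at h1
  obtain ⟨a, ha, h3, h4⟩ := exists_top (by omega) Nat.prime_two h1.1
  have h5 := h.not_dvd (q := 2 ^ (a + 1)) (by simpa using h4)
  have := h'.countP_le 2 a 1 Nat.prime_two ha one_ne_zero h5
  simp [← Multiset.cons_zero, Multiset.countP_cons, h3, h1.1] at this

lemma sig_dihedral_pair {n k m : ℕ} (hn : 2 ≤ n)
    (h : SigLink {2, 2, n} {k, m}) (h' : SigLink {k, m} {2, 2, n}) : False := by
  have h1 := h.dvd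
  have h2 := h'.dvd
  simp at h1 h2
  by_cases hev : 2 ∣ n
  · obtain ⟨a, ha, h3, h4⟩ := exists_top (by omega) Nat.prime_two hev
    have hS : ∀ s ∈ ({2, 2, n} : Multiset ℕ), ¬ 2 ^ (a + 1) ∣ s := by
      simpa using ⟨not_pow_succ_dvd_two ha, h4⟩
    have hT := h'.not_dvd hS
    have e1 := h'.countP_le 2 a 1 Nat.prime_two ha one_ne_zero hS
    have e2 := h.countP_le 2 a a Nat.prime_two ha ha hT
    have e3 := h.even a ha hT
    have e4 : 2 ^ a ∣ k ∨ 2 ^ a ∣ m := h1.2.imp h3.trans h3.trans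
    by_cases hk' : 2 ^ a ∣ k <;> by_cases hm' : 2 ^ a ∣ m <;> by_cases h2' : 2 ^ a ∣ 2 <;>
      simp [← Multiset.cons_zero, Multiset.countP_cons, h3, hk', hm', h2', hev] at e1 e2 e3 e4 <;>
      first | omega | exact absurd e3 (by decide) | (split_ifs at e1 <;> omega)
  · have hS : ∀ s ∈ ({2, 2, n} : Multiset ℕ), ¬ 2 ^ (1 + 1) ∣ s := by
      simp; omega
    have e1 := h'.countP_le 2 1 1 Nat.prime_two one_ne_zero one_ne_zero hS
    have hk2 : 2 ∣ k → k = 2 := by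
      intro hd
      rcases h2.1 with h | h
      · exact Nat.dvd_antisymm h hd
      · exact absurd (hd.trans h) hev
    have hm2 : 2 ∣ m → m = 2 := by
      intro hd
      rcases h2.2 with h | h
      · exact Nat.dvd_antisymm h hd
      · exact absurd (hd.trans h) hev
    by_cases hk' : 2 ∣ k <;> by_cases hm' : 2 ∣ m <;>
      simp [← Multiset.cons_zero, hk', hm', hev] at e1 h1
    rw [hk2 hk', hm2 hm'] at h1
    have := Nat.le_of_dvd (by norm_num) (h1.elim id id)
    interval_cases n
    simp at hev

lemma sig_dihedral_dihedral {n m : ℕ} (hn : 2 ≤ n) (hm : 2 ≤ m)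
    (h : SigLink {2, 2, n} {2, 2, m}) (h' : SigLink {2, 2, m} {2, 2, n}) : n = m := by
  have h1 := h.dvd
  have h2 := h'.dvd
  simp at h1 h2
  rcases h1 with h1 | h1
  · have : n = 2 := le_antisymm (Nat.le_of_dvd (by norm_num) h1) hn
    subst this
    have := Nat.le_of_dvd (by norm_num) (h2.elim id id)
    omega
  · rcases h2 with h2 | h2
    · have : m = 2 := le_antisymm (Nat.le_of_dvd (by norm_num) h2) hm
      subst this
      have := Nat.le_of_dvd (by norm_num) h1
      omega
    · exact Nat.dvd_antisymm h1 h2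

lemma SigLink.le {S T : Multiset ℕ} (h : SigLink S T) {N : ℕ} (hT : ∀ t ∈ T, 2 ≤ t ∧ t ≤ N) :
    ∀ s ∈ S, s ≤ N := by
  intro s hs
  obtain ⟨t, ht, hst⟩ := h.dvd s hs
  exact (Nat.le_of_dvd (by have := hT t ht; omega) hst).trans (hT t ht).2

lemma SigLink.eq_zero {S : Multiset ℕ} (h : SigLink S 0) : S = 0 := by
  refine Multiset.eq_zero_of_forall_notMem fun s hs => ?_
  simpa using h.dvd s hs

lemma sig_eq_of_flat {S T : Multiset ℕ}
    (hS : S = {3, 3, 3} ∨ S = {2, 4, 4} ∨ S = {2, 3, 6} ∨ S = {2, 2, 2, 2})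
    (hT : T = {3, 3, 3} ∨ T = {2, 4, 4} ∨ T = {2, 3, 6} ∨ T = {2, 2, 2, 2})
    (h : SigLink S T) (h' : SigLink T S) : S = T := by
  have h1 := h.dvd
  have h2 := h'.dvd
  rcases hS with rfl | rfl | rfl | rfl <;> rcases hT with rfl | rfl | rfl | rfl <;>
    first | rfl | (exfalso; simp at h1 h2)

lemma sig_eq_pair {n : ℕ} {T : Multiset ℕ} (hn : 2 ≤ n)
    (hT : T = 0 ∨ (∃ n, 2 ≤ n ∧ T = {n}) ∨ (∃ k m, 2 ≤ k ∧ k ≤ m ∧ T = {k, m}) ∨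
      (∃ n, 2 ≤ n ∧ T = {2, 2, n}) ∨ T = {2, 3, 3} ∨ T = {2, 3, 4} ∨ T = {2, 3, 5})
    (h : SigLink {n, n} T) (h' : SigLink T {n, n}) : {n, n} = T := by
  rcases hT with rfl | ⟨m, hm, rfl⟩ | ⟨k, m, hk, hkm, rfl⟩ | ⟨m, hm, rfl⟩ | rfl | rfl | rfl
  · exact h.eq_zero
  · exact (sig_pair_single hn h h').elim
  · exact sig_pair_pair hn hkm hk h h'
  · exact (sig_pair_dihedral hn hm h h').elim
  all_goals
    have h1 := h.le (N := 5) (by simp)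
    have h2 := h'.dvd
    simp at h1 h2
    omega

lemma sig_eq_dihedral {n : ℕ} {T : Multiset ℕ} (hn : 2 ≤ n)
    (hT : T = 0 ∨ (∃ n, 2 ≤ n ∧ T = {n}) ∨ (∃ k m, 2 ≤ k ∧ k ≤ m ∧ T = {k, m}) ∨
      (∃ n, 2 ≤ n ∧ T = {2, 2, n}) ∨ T = {2, 3, 3} ∨ T = {2, 3, 4} ∨ T = {2, 3, 5})
    (h : SigLink {2, 2, n} T) (h' : SigLink T {2, 2, n}) : {2, 2, n} = T := by
  rcases hT with rfl | ⟨m, hm, rfl⟩ | ⟨k, m, hk, hkm, rfl⟩ | ⟨m, hm, rfl⟩ | rfl | rfl | rfl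
  · exact h.eq_zero
  · exact (sig_dihedral_single hm h h').elim
  · exact (sig_dihedral_pair hn h h').elim
  · rw [sig_dihedral_dihedral hn hm h h']
  · have h1 := h.le (N := 3) (by simp)
    have h2 := h'.dvd
    simp at h1 h2
    obtain rfl : n = 3 := by omega
    have := h.countP_le 3 1 1 Nat.prime_three (by simp) (by simp) (by simp)
    simp [← Multiset.cons_zero] at this
  all_goals
    have h1 := h.le (N := 5) (by simp)
    have h2 := h'.dvd
    simp at h1 h2
    omega

lemma sig_eq_polyhedral {S T : Multiset ℕ} (hS : S = {2, 3, 3} ∨ S = {2, 3, 4} ∨ S = {2, 3, 5})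
    (hT : T = 0 ∨ (∃ n, 2 ≤ n ∧ T = {n}) ∨ (∃ k m, 2 ≤ k ∧ k ≤ m ∧ T = {k, m}) ∨
      (∃ n, 2 ≤ n ∧ T = {2, 2, n}) ∨ T = {2, 3, 3} ∨ T = {2, 3, 4} ∨ T = {2, 3, 5})
    (h : SigLink S T) (h' : SigLink T S) : S = T := by
  have hS5 : ∀ s ∈ S, 2 ≤ s ∧ s ≤ 5 := by rcases hS with rfl | rfl | rfl <;> simp
  have h2 := h.dvd
  have h3 := h'.dvd
  have h4 := h'.le hS5
  rcases hT with rfl | ⟨m, hm, rfl⟩ | ⟨k, m, hk, hkm, rfl⟩ | ⟨m, hm, rfl⟩ | hT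
  · exact h.eq_zero
  · rcases hS with rfl | rfl | rfl <;> simp at h2 h4 <;> omega
  · exfalso
    rcases hS with rfl | rfl | rfl <;> simp at h2 h3 h4 <;> obtain ⟨h5, h6⟩ := h4 <;>
      interval_cases k <;> interval_cases m <;> simp at h2 h3
    · have := h'.countP_le 3 1 1 Nat.prime_three (by simp) (by simp) (by simp)
      simp [← Multiset.cons_zero] at this
    · have := h'.countP_le 2 2 1 Nat.prime_two (by simp) (by simp) (by simp)
      simp [← Multiset.cons_zero] at this
  · rw [eq_comm]
    refine sig_eq_dihedral hm ?_ h' h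
    tauto
  · rcases hS with rfl | rfl | rfl <;> rcases hT with rfl | rfl | rfl <;>
      first | rfl | (exfalso; simp at h2 h3)

/-- Linked signatures of nonnegative Euler characteristic coincide when one of them is good. -/
lemma SigLink.eq {S T : Multiset ℕ} (h : SigLink S T) (h' : SigLink T S)
    (hS : ∀ n ∈ S, 2 ≤ n) (hT : ∀ n ∈ T, 2 ≤ n) (hS0 : 0 ≤ sigChi S) (hT0 : 0 ≤ sigChi T)
    (hST : sigChi S = 0 ↔ sigChi T = 0) (hS1 : ∀ n, S ≠ {n})
    (hS2 : ∀ k m, S = {k, m} → k = m) : S = T := by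
  rcases classify hS hS0 with ⟨hpos, hS⟩ | ⟨hzero, hS⟩ <;>
    rcases classify hT hT0 with ⟨hpos', hT⟩ | ⟨hzero', hT⟩
  · rcases hS with rfl | ⟨n, -, rfl⟩ | ⟨k, m, hk, -, rfl⟩ | ⟨n, hn, rfl⟩ | hS
    · exact h'.eq_zero.symm
    · exact absurd rfl (hS1 n)
    · obtain rfl := hS2 k m rfl
      exact sig_eq_pair hk hT h h'
    · exact sig_eq_dihedral hn hT h h'
    · exact sig_eq_polyhedral hS hT h h'
  · exact absurd (hST.mpr hzero') hpos.ne'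
  · exact absurd (hST.mp hzero) hpos'.ne'
  · exact sig_eq_of_flat hS hT (by assumption) (by assumption)

/-- A signature of nonnegative Euler characteristic other than `{2,2,2,2}` has at most three
elements. -/
lemma card_le_three {S : Multiset ℕ} (hS : ∀ n ∈ S, 2 ≤ n) (hchi : 0 ≤ sigChi S)
    (hne : S ≠ {2, 2, 2, 2}) : S.card ≤ 3 := by
  rcases classify hS hchi with ⟨-, rfl | ⟨n, -, rfl⟩ | ⟨k, m, -, -, rfl⟩ | ⟨n, -, rfl⟩ | rfl |
    rfl | rfl⟩ | ⟨-, rfl | rfl | rfl | rfl⟩ <;> first | exact absurd rfl hne | simp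

lemma exists_preimage {f : RatFunc ℂ} (hf : Nonconst f) (T : Finset (OnePoint ℂ)) :
    ∃ F : Finset (OnePoint ℂ), (∀ z, z ∈ F ↔ evalOP f z ∈ T) ∧
      ∀ g : OnePoint ℂ → ℚ, ∑ z ∈ F, (locDeg f z : ℚ) * g (evalOP f z) =
        rdeg f * ∑ x ∈ T, g x := by
  choose F hF hsum using exists_fibre hf
  have hmem : ∀ z, z ∈ T.biUnion F ↔ evalOP f z ∈ T := fun z => by
    simp [hF]
  refine ⟨T.biUnion F, hmem, fun g => ?_⟩
  rw [← Finset.sum_fiberwise_of_maps_to (g := evalOP f) (t := T) fun z hz => (hmem z).mp hz,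
    Finset.mul_sum]
  refine Finset.sum_congr rfl fun x hx => ?_
  have : (T.biUnion F).filter (fun z => evalOP f z = x) = F x := by
    ext z
    simp only [Finset.mem_filter, hmem, hF]
    constructor
    · exact fun h => h.2
    · rintro rfl; exact ⟨hx, rfl⟩
  rw [this, ← hsum x, Nat.cast_sum, Finset.sum_mul]
  exact Finset.sum_congr rfl fun z hz => by rw [(hF x z).mp hz]

lemma gcd_mul_of_eq {a b m n : ℕ} (hn : 0 < n) (h : n = m * Nat.gcd a n) :
    Nat.gcd (b * a) n = Nat.gcd b m * Nat.gcd a n := by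
  have hg : 0 < Nat.gcd a n := Nat.gcd_pos_of_pos_right _ hn
  obtain ⟨a', ha⟩ := Nat.gcd_dvd_left a n
  set g := Nat.gcd a n with hgdef
  have hcop : Nat.Coprime a' m := by
    have : Nat.gcd (g * a') (g * m) = g := by rw [← ha, mul_comm g m, ← h]
    rw [Nat.gcd_mul_left] at this
    exact Nat.eq_of_mul_eq_mul_left hg (this.trans (mul_one g).symm)
  conv_lhs => rw [ha, h]
  rw [show b * (g * a') = (b * a') * g by ring, Nat.gcd_mul_right,
    Nat.Coprime.gcd_mul_right_cancel _ hcop]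

lemma IsMinHolo.comp {U V : RatFunc ℂ} {O₁ O₂ O₃ : Orbifold} (hU : Nonconst U) (hV : Nonconst V)
    (h₂ : IsMinHolo U O₂ O₃) (h₁ : IsMinHolo V O₁ O₂) : IsMinHolo (rcomp U V) O₁ O₃ := by
  intro z
  rw [evalOP_rcomp hU hV, locDeg_rcomp hU hV, gcd_mul_of_eq (O₃.one_le _) (h₂ _), ← mul_assoc,
    ← h₁ z]
  exact h₂ _

lemma IsMinHolo.of_comp {U V : RatFunc ℂ} {O₁ O₂ O₃ : Orbifold} (hU : Nonconst U)
    (hV : Nonconst V) (h : IsMinHolo (rcomp U V) O₁ O₃) (h₂ : IsMinHolo U O₂ O₃) :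
    IsMinHolo V O₁ O₂ := by
  intro z
  have h := h z
  rw [evalOP_rcomp hU hV, locDeg_rcomp hU hV, gcd_mul_of_eq (O₃.one_le _) (h₂ _), ← mul_assoc]
    at h
  exact Nat.eq_of_mul_eq_mul_right (Nat.gcd_pos_of_pos_right _ (O₃.one_le _))
    ((h₂ (evalOP V z)).symm.trans h)

/-- The pullback `U*O` of an orbifold. -/
def Orbifold.pullback (U : RatFunc ℂ) (hU : Nonconst U) (O : Orbifold) : Orbifold where
  nu z := O.nu (evalOP U z) / Nat.gcd (locDeg U z) (O.nu (evalOP U z))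
  one_le z := Nat.div_pos (Nat.le_of_dvd (O.one_le _) (Nat.gcd_dvd_right _ _))
    (Nat.gcd_pos_of_pos_right _ (O.one_le _))
  finite := by
    obtain ⟨F, hF, -⟩ := exists_preimage hU O.finite.toFinset
    refine F.finite_toSet.subset fun z hz => (hF z).mpr ?_
    rw [Set.Finite.mem_toFinset]
    intro h1
    exact hz (by simp [h1])

lemma isMinHolo_pullback {U : RatFunc ℂ} (hU : Nonconst U) (O : Orbifold) :
    IsMinHolo U (O.pullback U hU) O :=
  fun _ => (Nat.div_mul_cancel (Nat.gcd_dvd_right _ _)).symm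

lemma Orbifold.mem_signature {O : Orbifold} {n : ℕ} :
    n ∈ O.signature ↔ n ≠ 1 ∧ ∃ z, O.nu z = n := by
  simp only [signature, Multiset.mem_map, Finset.mem_val, Set.Finite.mem_toFinset,
    Set.mem_ofPred_eq]
  constructor
  · rintro ⟨z, hz, rfl⟩; exact ⟨hz, z, rfl⟩
  · rintro ⟨hn, z, rfl⟩; exact ⟨z, hn, rfl⟩

lemma Orbifold.two_le_of_mem_signature (O : Orbifold) : ∀ n ∈ O.signature, 2 ≤ n := by
  intro n hn
  obtain ⟨h1, z, rfl⟩ := mem_signature.mp hn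
  have := O.one_le z
  omega

lemma Orbifold.sigChi_signature (O : Orbifold) : sigChi O.signature = O.eulerChar := by
  rw [sigChi, signature, Multiset.map_map]
  rfl

/-- The points where the ramification function is divisible by `q`. -/
def Orbifold.multiples (O : Orbifold) (q : ℕ) : Finset (OnePoint ℂ) :=
  O.finite.toFinset.filter (q ∣ O.nu ·)

lemma Orbifold.mem_multiples {O : Orbifold} {q : ℕ} (hq : q ≠ 1) {z : OnePoint ℂ} :
    z ∈ O.multiples q ↔ q ∣ O.nu z := by
  simp only [multiples, Finset.mem_filter, Set.Finite.mem_toFinset, Set.mem_ofPred_eq,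
    and_iff_right_iff_imp]
  intro h h1
  rw [h1] at h
  exact hq (Nat.dvd_one.mp h)

lemma Orbifold.countP_signature (O : Orbifold) (q : ℕ) :
    O.signature.countP (q ∣ ·) = (O.multiples q).card := by
  rw [signature, Multiset.countP_map]
  rfl

lemma Orbifold.not_dvd_nu {O : Orbifold} {q : ℕ} (hq : q ≠ 1)
    (h : ∀ t ∈ O.signature, ¬ q ∣ t) (z : OnePoint ℂ) : ¬ q ∣ O.nu z := by
  by_cases hz : O.nu z = 1
  · rwa [hz, Nat.dvd_one]
  · exact h _ (mem_signature.mpr ⟨hz, z, rfl⟩)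

lemma pow_ne_one {p a : ℕ} (hp : p.Prime) (ha : a ≠ 0) : p ^ a ≠ 1 :=
  (Nat.one_lt_pow ha hp.one_lt).ne'

lemma dvd_left_of_not_dvd {p b m n e : ℕ} (hp : p.Prime) (h : n = m * Nat.gcd e n)
    (he : ¬ p ∣ e) (hn : p ^ b ∣ n) : p ^ b ∣ m := by
  rw [h] at hn
  exact (Nat.Coprime.pow_left b ((Nat.Prime.coprime_iff_not_dvd hp).mpr fun hd =>
    he (hd.trans (Nat.gcd_dvd_left _ _)))).dvd_of_dvd_mul_right hn

lemma dvd_left_iff {p a m n e : ℕ} (hp : p.Prime) (ha : a ≠ 0) (h : n = m * Nat.gcd e n)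
    (hn : ¬ p ^ (a + 1) ∣ n) : p ^ a ∣ m ↔ p ^ a ∣ n ∧ ¬ p ∣ e := by
  refine ⟨fun hm => ?_, fun ⟨h1, h2⟩ => dvd_left_of_not_dvd hp h h2 h1⟩
  have hmn : m ∣ n := Dvd.intro _ h.symm
  refine ⟨hm.trans hmn, fun he => hn ?_⟩
  rw [h, pow_succ]
  exact mul_dvd_mul hm (Nat.dvd_gcd he ((dvd_pow_self p ha).trans (hm.trans hmn)))

lemma IsMinHolo.sigLink {A : RatFunc ℂ} (hA : Nonconst A) {O₁ O₂ : Orbifold}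
    (h : IsMinHolo A O₁ O₂) : SigLink O₁.signature O₂.signature where
  dvd := by
    intro s hs
    obtain ⟨hs1, z, rfl⟩ := Orbifold.mem_signature.mp hs
    have hd : O₁.nu z ∣ O₂.nu (evalOP A z) := Dvd.intro _ (h z).symm
    exact ⟨_, Orbifold.mem_signature.mpr ⟨fun h1 => hs1 (Nat.dvd_one.mp (h1 ▸ hd)), _, rfl⟩, hd⟩
  countP_le := by
    intro p a b hp ha hb htop h1
    rw [Orbifold.countP_signature, Finset.card_eq_one] at h1
    obtain ⟨z₀, hz₀⟩ := h1
    have htop' := Orbifold.not_dvd_nu (pow_ne_one hp a.succ_ne_zero) htop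
    have hiff : ∀ z, p ^ a ∣ O₁.nu z ↔ z = z₀ := fun z => by
      rw [← Orbifold.mem_multiples (pow_ne_one hp ha), hz₀, Finset.mem_singleton]
    have key : ∀ z, z = z₀ ↔ p ^ a ∣ O₂.nu (evalOP A z) ∧ ¬ p ∣ locDeg A z := fun z => by
      rw [← hiff, dvd_left_iff hp ha (h z) (htop' _)]
    have hdeg : ¬ p ∣ rdeg A := by
      obtain ⟨F, hF, hsum⟩ := exists_fibre hA (evalOP A z₀)
      rw [← hsum, ← Finset.add_sum_erase F _ ((hF z₀).mpr rfl), Nat.dvd_add_left]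
      · exact ((key z₀).mp rfl).2
      · refine Finset.dvd_sum fun z hz => ?_
        obtain ⟨hz1, hz2⟩ := Finset.mem_erase.mp hz
        by_contra hd
        refine hz1 ((key z).mpr ⟨?_, hd⟩)
        rw [(hF z).mp hz2]
        exact ((key z₀).mp rfl).1
    have hsec : ∀ x, ∃ z, evalOP A z = x ∧ ¬ p ∣ locDeg A z := by
      intro x
      by_contra! hcon
      obtain ⟨F, hF, hsum⟩ := exists_fibre hA x
      exact hdeg (hsum ▸ Finset.dvd_sum fun z hz => hcon z ((hF z).mp hz))
    choose s hs hs' using hsec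
    rw [Orbifold.countP_signature, Orbifold.countP_signature]
    refine Finset.card_le_card_of_injOn s (fun x hx => ?_)
      (Function.LeftInverse.injective hs).injOn
    have hx := (Orbifold.mem_multiples (pow_ne_one hp hb)).mp hx
    exact (Orbifold.mem_multiples (pow_ne_one hp hb)).mpr
      (dvd_left_of_not_dvd hp (h (s x)) (hs' x) (by rwa [hs x]))
  even := by
    intro a ha htop hev
    rw [Orbifold.countP_signature] at hev ⊢
    have hq := pow_ne_one Nat.prime_two ha
    have htop' := Orbifold.not_dvd_nu (pow_ne_one Nat.prime_two a.succ_ne_zero) htop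
    obtain ⟨F, hF, hsum⟩ := exists_preimage hA (O₂.multiples (2 ^ a))
    have hsum' : ∑ z ∈ F, locDeg A z = rdeg A * (O₂.multiples (2 ^ a)).card := by
      have := hsum fun _ => 1
      simp only [mul_one, Finset.sum_const, nsmul_eq_mul] at this
      exact_mod_cast this
    have hfilter : O₁.multiples (2 ^ a) = F.filter (fun z => Odd (locDeg A z)) := by
      ext z
      rw [Orbifold.mem_multiples hq, dvd_left_iff Nat.prime_two ha (h z) (htop' _),
        Finset.mem_filter, hF, Orbifold.mem_multiples hq, ← Nat.not_even_iff_odd,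
        even_iff_two_dvd]
    rw [hfilter, ← Finset.even_sum_iff_even_card_odd, hsum']
    exact hev.mul_left _

lemma Orbifold.eulerChar_eq_of_subset (O : Orbifold) {F : Finset (OnePoint ℂ)}
    (hF : ∀ z, O.nu z ≠ 1 → z ∈ F) :
    O.eulerChar = 2 + ∑ z ∈ F, ((O.nu z : ℚ)⁻¹ - 1) := by
  rw [eulerChar]
  congr 1
  refine Finset.sum_subset (fun z hz => hF z (by simpa using hz)) fun z _ hz => ?_
  have : O.nu z = 1 := by simpa using hz
  simp [this]

/-- The Riemann–Hurwitz inequality for minimal holomorphic maps. -/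
lemma IsMinHolo.eulerChar_le {A : RatFunc ℂ} (hA : Nonconst A) {O₁ O₂ : Orbifold}
    (h : IsMinHolo A O₁ O₂) : O₁.eulerChar ≤ rdeg A * O₂.eulerChar := by
  obtain ⟨F, hF, hsum⟩ := exists_preimage hA O₂.finite.toFinset
  have hsub : ∀ z, O₁.nu z ≠ 1 → z ∈ F := by
    intro z hz
    rw [hF, Set.Finite.mem_toFinset]
    intro h1
    exact hz (Nat.dvd_one.mp (h1 ▸ Dvd.intro _ (h z).symm))
  rw [O₁.eulerChar_eq_of_subset hsub, Orbifold.eulerChar, mul_add, ← hsum]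
  have hRH : ∑ z ∈ F, ((locDeg A z : ℚ) - 1) ≤ 2 * rdeg A - 2 := by
    exact_mod_cast sum_locDeg_sub_one_le hA F
  have hterm : ∑ z ∈ F, ((O₁.nu z : ℚ)⁻¹ - 1) ≤
      ∑ z ∈ F, ((locDeg A z : ℚ) * ((O₂.nu (evalOP A z) : ℚ)⁻¹ - 1) + ((locDeg A z : ℚ) - 1)) := by
    refine Finset.sum_le_sum fun z _ => ?_
    have h2 : (0 : ℚ) < O₂.nu (evalOP A z) := by exact_mod_cast O₂.one_le _
    have h1 : (0 : ℚ) < O₁.nu z := by exact_mod_cast O₁.one_le _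
    have hle : O₂.nu (evalOP A z) ≤ O₁.nu z * locDeg A z := by
      conv_lhs => rw [h z]
      exact Nat.mul_le_mul_left _ (Nat.le_of_dvd (locDeg_pos hA z) (Nat.gcd_dvd_left _ _))
    have hle' : (O₂.nu (evalOP A z) : ℚ) ≤ O₁.nu z * locDeg A z := by exact_mod_cast hle
    have : (O₁.nu z : ℚ)⁻¹ ≤ locDeg A z * (O₂.nu (evalOP A z) : ℚ)⁻¹ := by
      rw [← div_eq_mul_inv, le_div_iff₀ h2, inv_mul_le_iff₀ h1]
      exact hle'
    linarith
  rw [Finset.sum_add_distrib] at hterm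
  linarith

lemma Orbifold.exists_list (O : Orbifold) {l : List ℕ} (h : O.signature = l) :
    ∃ L : List (OnePoint ℂ), L.Nodup ∧ (∀ z, z ∈ L ↔ O.nu z ≠ 1) ∧ L.map O.nu = l := by
  have hperm : l.Perm (O.finite.toFinset.toList.map O.nu) := by
    rw [← Multiset.coe_eq_coe, ← h, signature, ← Multiset.map_coe, Finset.coe_toList]
  obtain ⟨L, hL, hp⟩ := (congrFun₂ (List.eq_map_comp_perm O.nu) _ _).mpr hperm
  refine ⟨L, hp.nodup_iff.mpr (Finset.nodup_toList _), fun z => ?_, hL.symm⟩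
  rw [hp.mem_iff, Finset.mem_toList, Set.Finite.mem_toFinset]
  rfl

lemma Orbifold.Good.signature_ne_singleton {O : Orbifold} (hO : O.Good) (n : ℕ) :
    O.signature ≠ {n} := by
  intro h
  obtain ⟨L, -, hmem, hmap⟩ := O.exists_list (l := [n]) h
  obtain ⟨z, rfl⟩ := List.length_eq_one_iff.mp (by simpa using congrArg List.length hmap)
  exact hO.1 ⟨z, by ext w; simp [← hmem]⟩

lemma Orbifold.Good.eq_of_signature_pair {O : Orbifold} (hO : O.Good) (k m : ℕ)
    (h : O.signature = {k, m}) : k = m := by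
  obtain ⟨L, hnd, hmem, hmap⟩ := O.exists_list (l := [k, m]) h
  obtain ⟨z, w, rfl⟩ := List.length_eq_two.mp (by simpa using congrArg List.length hmap)
  by_contra hne
  simp only [List.map_cons, List.map_nil, List.cons.injEq, and_true] at hmap
  refine hO.2 ⟨z, w, by simpa using hnd, by ext v; simp [← hmem], ?_⟩
  rwa [hmap.1, hmap.2]

/-- A pair of mutually inverse Möbius transformations. -/
structure IsMobius (μ ν : RatFunc ℂ) : Prop where
  left : Nonconst μ
  right : Nonconst ν
  comp : rcomp μ ν = RatFunc.X
  comp' : rcomp ν μ = RatFunc.X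

lemma IsMobius.symm {μ ν : RatFunc ℂ} (h : IsMobius μ ν) : IsMobius ν μ :=
  ⟨h.right, h.left, h.comp', h.comp⟩

lemma rcomp_X_left {f : RatFunc ℂ} (hf : Nonconst f) : rcomp RatFunc.X f = f := by
  rw [← compHom_apply f hf, compHom_X]

lemma nonconst_X : Nonconst RatFunc.X :=
  nonconst_of_rord (x := (0 : ℂ)) (z := (0 : ℂ)) (by rw [coord_coe, rord_X_sub_C]; simp)

lemma IsMobius.trans {μ ν μ' ν' : RatFunc ℂ} (h : IsMobius μ ν) (h' : IsMobius μ' ν') :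
    IsMobius (rcomp μ' μ) (rcomp ν ν') where
  left := nonconst_rcomp h'.left h.left
  right := nonconst_rcomp h.right h'.right
  comp := by
    rw [rcomp_assoc _ _ (nonconst_rcomp h.right h'.right), ← rcomp_assoc _ _ h'.right, h.comp,
      rcomp_X_left h'.right, h'.comp]
  comp' := by
    rw [rcomp_assoc _ _ (nonconst_rcomp h'.left h.left), ← rcomp_assoc _ _ h.left, h'.comp',
      rcomp_X_left h.left, h.comp']

lemma rord_coord_X (z : OnePoint ℂ) : rord z (coord z RatFunc.X) = 1 := by
  induction z using OnePoint.rec with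
  | infty => simp
  | coe c => rw [coord_coe, rord_X_sub_C]; simp

lemma evalOP_X (z : OnePoint ℂ) : evalOP RatFunc.X z = z := by
  rw [evalOP_eq_iff nonconst_X, rord_coord_X]
  exact one_pos

lemma locDeg_X (z : OnePoint ℂ) : locDeg RatFunc.X z = 1 := by
  have := locDeg_eq nonconst_X (evalOP_X z)
  rw [rord_coord_X] at this
  exact_mod_cast this

lemma isMobius_X : IsMobius RatFunc.X RatFunc.X :=
  ⟨nonconst_X, nonconst_X, rcomp_X_left nonconst_X, rcomp_X_left nonconst_X⟩

lemma IsMobius.evalOP_evalOP {μ ν : RatFunc ℂ} (h : IsMobius μ ν) (z : OnePoint ℂ) :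
    evalOP μ (evalOP ν z) = z := by
  rw [← evalOP_rcomp h.left h.right, h.comp, evalOP_X]

lemma IsMobius.locDeg_eq_one {μ ν : RatFunc ℂ} (h : IsMobius μ ν) (z : OnePoint ℂ) :
    locDeg μ z = 1 := by
  have := locDeg_rcomp h.right h.left z
  rw [h.comp', locDeg_X] at this
  exact Nat.eq_one_of_mul_eq_one_right this.symm

lemma IsMobius.isMinHolo {μ ν : RatFunc ℂ} (h : IsMobius μ ν) {O₁ O₂ : Orbifold}
    (hnu : ∀ z, O₂.nu (evalOP μ z) = O₁.nu z) : IsMinHolo μ O₁ O₂ := by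
  intro z
  rw [h.locDeg_eq_one, Nat.gcd_one_left, mul_one, hnu]

lemma exists_mobius_infty (a : OnePoint ℂ) : ∃ μ ν, IsMobius μ ν ∧ evalOP μ a = ∞ := by
  induction a using OnePoint.rec with
  | infty => exact ⟨_, _, isMobius_X, evalOP_X _⟩
  | coe a =>
    have h : 0 < rord a (coord ∞ (RatFunc.X - RatFunc.C a)⁻¹) := by
      rw [coord_infty, inv_inv, rord_X_sub_C]
      simp
    have h' : 0 < rord ∞ (coord a (RatFunc.X⁻¹ + RatFunc.C a)) := by
      rw [coord_coe, add_sub_cancel_right, rord_inv, rord_infty, RatFunc.intDegree_X]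
      simp
    have hμ := nonconst_of_rord h
    have hν := nonconst_of_rord h'
    refine ⟨_, _, ⟨hμ, hν, ?_, ?_⟩, (evalOP_eq_iff hμ).mpr h⟩
    · rw [← compHom_apply _ hν, map_inv₀, map_sub, compHom_X, compHom_C, add_sub_cancel_right,
        inv_inv]
    · rw [← compHom_apply _ hμ, map_add, map_inv₀, compHom_X, compHom_C, inv_inv, sub_add_cancel]

lemma exists_mobius_affine {b c : ℂ} (hbc : b ≠ c) :
    ∃ μ ν, IsMobius μ ν ∧ evalOP μ ∞ = ∞ ∧ evalOP μ b = (0 : ℂ) ∧ evalOP μ c = (1 : ℂ) := by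
  have hk : c - b ≠ 0 := sub_ne_zero.mpr hbc.symm
  have hk' : (RatFunc.C (c - b) : RatFunc ℂ) ≠ 0 := by
    rwa [Ne, map_eq_zero]
  have hX : ∀ w : ℂ, (RatFunc.X - RatFunc.C w : RatFunc ℂ) ≠ 0 := nonconst_X.sub_C_ne_zero
  set μ : RatFunc ℂ := (RatFunc.X - RatFunc.C b) / RatFunc.C (c - b) with hμdef
  have hrord : ∀ x (w : ℂ), rord x ((RatFunc.X - RatFunc.C w) / RatFunc.C (c - b)) =
      rord x (RatFunc.X - RatFunc.C w) := fun x w => by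
    rw [rord_div x (hX w) hk', rord_C, sub_zero]
  have h0 : 0 < rord b (coord (0 : ℂ) μ) := by
    rw [coord_coe, map_zero, sub_zero, hrord, rord_X_sub_C]
    simp
  have h1 : 0 < rord c (coord (1 : ℂ) μ) := by
    have : μ - RatFunc.C 1 = (RatFunc.X - RatFunc.C c) / RatFunc.C (c - b) := by
      rw [hμdef, map_one, div_sub_one hk', map_sub]
      ring
    rw [coord_coe, this, hrord, rord_X_sub_C]
    simp
  have h2 : 0 < rord ∞ (coord ∞ μ) := by
    rw [coord_infty, rord_inv, hrord, rord_X_sub_C]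
    simp
  have hμ := nonconst_of_rord h0
  have hν : Nonconst (RatFunc.X * RatFunc.C (c - b) + RatFunc.C b) := by
    refine nonconst_of_rord (x := b) (z := (0 : ℂ)) ?_
    rw [coord_coe, add_sub_cancel_right, rord_mul _ RatFunc.X_ne_zero hk', rord_C]
    have := rord_coord_X (0 : ℂ)
    rw [coord_coe, map_zero, sub_zero] at this
    simp [this]
  refine ⟨μ, _, ⟨hμ, hν, ?_, ?_⟩, (evalOP_eq_iff hμ).mpr h2, (evalOP_eq_iff hμ).mpr h0,
    (evalOP_eq_iff hμ).mpr h1⟩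
  · rw [← compHom_apply _ hν, hμdef, map_div₀, map_sub, compHom_X, compHom_C, compHom_C,
      add_sub_cancel_right, mul_div_cancel_right₀ _ hk']
  · rw [← compHom_apply _ hμ, map_add, map_mul, compHom_X, compHom_C, compHom_C, hμdef,
      div_mul_cancel₀ _ hk', sub_add_cancel]

lemma exists_mobius_standard {a b c : OnePoint ℂ} (hab : a ≠ b) (hac : a ≠ c) (hbc : b ≠ c) :
    ∃ μ ν, IsMobius μ ν ∧ evalOP μ a = ∞ ∧ evalOP μ b = (0 : ℂ) ∧ evalOP μ c = (1 : ℂ) := by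
  obtain ⟨μ, ν, h, ha⟩ := exists_mobius_infty a
  have hinj : Function.Injective (evalOP μ) := Function.LeftInverse.injective h.symm.evalOP_evalOP
  obtain ⟨b', hb⟩ := OnePoint.ne_infty_iff_exists.mp (ha ▸ hinj.ne hab.symm)
  obtain ⟨c', hc⟩ := OnePoint.ne_infty_iff_exists.mp (ha ▸ hinj.ne hac.symm)
  have hbc' : b' ≠ c' := by
    rintro rfl
    exact hbc (hinj (hb.symm.trans hc))
  obtain ⟨μ', ν', h', ha', hb', hc'⟩ := exists_mobius_affine hbc'
  refine ⟨_, _, h.trans h', ?_, ?_, ?_⟩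
  · rw [evalOP_rcomp h'.left h.left, ha, ha']
  · rw [evalOP_rcomp h'.left h.left, ← hb, hb']
  · rw [evalOP_rcomp h'.left h.left, ← hc, hc']

lemma exists_mobius_triple {a b c a' b' c' : OnePoint ℂ} (hab : a ≠ b) (hac : a ≠ c) (hbc : b ≠ c)
    (hab' : a' ≠ b') (hac' : a' ≠ c') (hbc' : b' ≠ c') :
    ∃ μ ν, IsMobius μ ν ∧ evalOP μ a = a' ∧ evalOP μ b = b' ∧ evalOP μ c = c' := by
  obtain ⟨μ, ν, h, ha, hb, hc⟩ := exists_mobius_standard hab hac hbc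
  obtain ⟨μ', ν', h', ha', hb', hc'⟩ := exists_mobius_standard hab' hac' hbc'
  refine ⟨_, _, h.trans h'.symm, ?_, ?_, ?_⟩
  · rw [evalOP_rcomp h'.right h.left, ha, ← ha', h'.symm.evalOP_evalOP]
  · rw [evalOP_rcomp h'.right h.left, hb, ← hb', h'.symm.evalOP_evalOP]
  · rw [evalOP_rcomp h'.right h.left, hc, ← hc', h'.symm.evalOP_evalOP]

/-- Möbius transformations act transitively on tuples of at most three distinct points. -/
lemma exists_mobius_list : ∀ {L L' : List (OnePoint ℂ)}, L.Nodup → L'.Nodup →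
    L.length = L'.length → L.length ≤ 3 → ∃ μ ν, IsMobius μ ν ∧ L.map (evalOP μ) = L'
  | [], [], _, _, _, _ => ⟨_, _, isMobius_X, rfl⟩
  | [a], [a'], _, _, _, _ => by
    obtain ⟨b, hb⟩ := Infinite.exists_notMem_finset ({a} : Finset (OnePoint ℂ))
    obtain ⟨c, hc⟩ := Infinite.exists_notMem_finset ({a, b} : Finset (OnePoint ℂ))
    obtain ⟨b', hb'⟩ := Infinite.exists_notMem_finset ({a'} : Finset (OnePoint ℂ))
    obtain ⟨c', hc'⟩ := Infinite.exists_notMem_finset ({a', b'} : Finset (OnePoint ℂ))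
    simp only [Finset.mem_insert, Finset.mem_singleton, not_or] at hb hc hb' hc'
    obtain ⟨μ, ν, h, ha, -, -⟩ := exists_mobius_triple (Ne.symm hb) (Ne.symm hc.1) (Ne.symm hc.2)
      (Ne.symm hb') (Ne.symm hc'.1) (Ne.symm hc'.2)
    exact ⟨μ, ν, h, by simp [ha]⟩
  | [a, b], [a', b'], hL, hL', _, _ => by
    obtain ⟨c, hc⟩ := Infinite.exists_notMem_finset ({a, b} : Finset (OnePoint ℂ))
    obtain ⟨c', hc'⟩ := Infinite.exists_notMem_finset ({a', b'} : Finset (OnePoint ℂ))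
    simp only [Finset.mem_insert, Finset.mem_singleton, not_or] at hc hc'
    obtain ⟨μ, ν, h, ha, hb, -⟩ := exists_mobius_triple (by simpa using hL) (Ne.symm hc.1)
      (Ne.symm hc.2) (by simpa using hL') (Ne.symm hc'.1) (Ne.symm hc'.2)
    exact ⟨μ, ν, h, by simp [ha, hb]⟩
  | [a, b, c], [a', b', c'], hL, hL', _, _ => by
    have h1 : (a ≠ b ∧ a ≠ c) ∧ b ≠ c := by simpa using hL
    have h2 : (a' ≠ b' ∧ a' ≠ c') ∧ b' ≠ c' := by simpa using hL'
    obtain ⟨μ, ν, h, ha, hb, hc⟩ := exists_mobius_triple h1.1.1 h1.1.2 h1.2 h2.1.1 h2.1.2 h2.2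
    exact ⟨μ, ν, h, by simp [ha, hb, hc]⟩

/-- Orbifolds with the same signature of at most three elements are related by a Möbius
transformation. -/
lemma exists_mobius_of_signature_eq {O O' : Orbifold} (h : O.signature = O'.signature)
    (hcard : O.signature.card ≤ 3) :
    ∃ μ ν, IsMobius μ ν ∧ ∀ z, O'.nu (evalOP μ z) = O.nu z := by
  obtain ⟨L, hL, hmem, hmap⟩ := O.exists_list (Multiset.coe_toList _).symm
  obtain ⟨L', hL', hmem', hmap'⟩ := O'.exists_list
    (h.symm.trans (Multiset.coe_toList O.signature).symm)
  have hlen := congrArg List.length hmap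
  have hlen' := congrArg List.length hmap'
  rw [List.length_map, Multiset.length_toList] at hlen hlen'
  obtain ⟨μ, ν, hμ, hLL'⟩ := exists_mobius_list hL hL' (hlen.trans hlen'.symm) (hlen ▸ hcard)
  subst hLL'
  have hinj : Function.Injective (evalOP μ) := Function.LeftInverse.injective hμ.symm.evalOP_evalOP
  refine ⟨μ, ν, hμ, fun z => ?_⟩
  by_cases hz : z ∈ L
  · rw [List.map_map, ← hmap, List.map_inj_left] at hmap'
    exact hmap' z hz
  · have h1 : O.nu z = 1 := by rwa [hmem, not_not] at hz
    have h2 : evalOP μ z ∉ L.map (evalOP μ) := by rwa [List.mem_map_of_injective hinj]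
    rw [hmem', not_not] at h2
    rw [h1, h2]

/-- Orbifolds that map minimally onto each other in degrees at least two have the same
signature, of nonnegative Euler characteristic. -/
lemma signature_eq_of_isMinHolo {U V : RatFunc ℂ} {O O' : Orbifold} (hO : O.Good)
    (hU : 2 ≤ rdeg U) (hV : 2 ≤ rdeg V) (hUO : IsMinHolo U O' O) (hVO : IsMinHolo V O O') :
    O.signature = O'.signature ∧ 0 ≤ sigChi O.signature := by
  have hU' := nonconst_of_rdeg (one_le_two.trans hU)
  have hV' := nonconst_of_rdeg (one_le_two.trans hV)
  have h1 := hUO.eulerChar_le hU'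
  have h2 := hVO.eulerChar_le hV'
  have hdU : (2 : ℚ) ≤ rdeg U := by exact_mod_cast hU
  have hdV : (2 : ℚ) ≤ rdeg V := by exact_mod_cast hV
  have hpos : 0 ≤ O.eulerChar := by
    by_contra! hneg
    have h3 : O'.eulerChar ≤ 2 * O.eulerChar := by nlinarith
    nlinarith
  have hpos' : 0 ≤ O'.eulerChar := by nlinarith
  have hzero : O.eulerChar = 0 ↔ O'.eulerChar = 0 := by
    constructor <;> intro h0
    · rw [h0, mul_zero] at h1
      exact le_antisymm h1 hpos'
    · rw [h0, mul_zero] at h2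
      exact le_antisymm h2 hpos
  simp only [← Orbifold.sigChi_signature] at hpos hpos' hzero
  exact ⟨(hVO.sigLink hV').eq (hUO.sigLink hU') O.two_le_of_mem_signature
    O'.two_le_of_mem_signature hpos hpos' hzero hO.signature_ne_singleton
    hO.eq_of_signature_pair, hpos⟩

/-- **Theorem (compositions and decompositions in `E(O)`).** If `U, V ∈ E(O)` then
`U ∘ V ∈ E(O)`. Conversely, if `U ∘ V ∈ E(O)`, then the pullback orbifold `U*O` (whose
ramification function is `z ↦ ν(U(z))/gcd(deg_z U, ν(U(z)))`) has the same signature as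
`O`, the maps `V : O → U*O` and `U : U*O → O` are minimal holomorphic, and if the
signature of `O` is not `{2,2,2,2}` there is a Möbius transformation `μ` with
`U ∘ μ ∈ E(O)` and `μ⁻¹ ∘ V ∈ E(O)`. -/
theorem comp_decomp (O : Orbifold) (hO : O.Good) (U V : RatFunc ℂ)
    (hU : 2 ≤ rdeg U) (hV : 2 ≤ rdeg V) :
    (IsMinHolo U O O → IsMinHolo V O O → IsMinHolo (rcomp U V) O O) ∧
    (IsMinHolo (rcomp U V) O O →
      ∃ O' : Orbifold,
        (∀ z, O'.nu z = O.nu (evalOP U z) / Nat.gcd (locDeg U z) (O.nu (evalOP U z))) ∧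
        O'.signature = O.signature ∧
        IsMinHolo V O O' ∧ IsMinHolo U O' O ∧
        (O.signature ≠ ({2, 2, 2, 2} : Multiset ℕ) →
          ∃ μ ν : RatFunc ℂ, rcomp μ ν = RatFunc.X ∧ rcomp ν μ = RatFunc.X ∧
            IsMinHolo (rcomp U μ) O O ∧ IsMinHolo (rcomp ν V) O O)) := by
  have hU' := nonconst_of_rdeg (one_le_two.trans hU)
  have hV' := nonconst_of_rdeg (one_le_two.trans hV)
  refine ⟨fun h₂ h₁ => h₂.comp hU' hV' h₁, fun h => ?_⟩
  have hUO := isMinHolo_pullback hU' O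
  have hVO := h.of_comp hU' hV' hUO
  obtain ⟨hsig, hchi⟩ := signature_eq_of_isMinHolo hO hU hV hUO hVO
  refine ⟨O.pullback U hU', fun _ => rfl, hsig.symm, hVO, hUO, fun hne => ?_⟩
  obtain ⟨μ, ν, hμ, hnu⟩ := exists_mobius_of_signature_eq hsig
    (card_le_three O.two_le_of_mem_signature hchi hne)
  refine ⟨μ, ν, hμ.comp, hμ.comp', hUO.comp hU' hμ.left (hμ.isMinHolo hnu),
    IsMinHolo.comp hμ.right hV' (hμ.symm.isMinHolo fun z => ?_) hVO⟩
  rw [← hnu, hμ.evalOP_evalOP]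

end GenLattes
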